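/- Define f(t) = t² + 2t − 15 for integers t ≥ 3 (so f(3) = 0 and f(t) = f(t−1) + 2t + 1 for t ≥ 4; in particular f is increasing and f(t) = O(t²)). For every integer t ≥ 3 and every positive integer k, if S_1, S_2, …, S_t are pairwise vertex-disjoint subsets of a loopless multigraph G and each S_i is ((2t+3)k + f(t))-edge-connected in G, then there exists a packing of k pairwise edge-disjoint (S_1,…,S_t)-forests in G. -/

import Mathlib

/-!
Multigraphs are modelled by a vertex type `V`, an edge type `E`, and an
incidence map `ends : E → Sym2 V` giving the (unordered) pair of endpoints
of each edge.  Subgraphs are identified with their edge sets (`Set E`).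
-/

namespace SteinerPacking

variable {V E : Type}

/-- The set of edges incident to a vertex `u` (denoted `E(u)` in the paper). -/
def incEdges (ends : E → Sym2 V) (u : V) : Set E := {e | u ∈ ends e}

/-- The degree `d(u) = |E(u)|` of a vertex. -/
noncomputable def deg (ends : E → Sym2 V) (u : V) : ℕ := (incEdges ends u).ncard

/-- One step along an edge of the edge set `F`. -/
def Step (ends : E → Sym2 V) (F : Set E) (a b : V) : Prop := ∃ e ∈ F, ends e = s(a, b)

/-- `a` and `b` are joined by a walk using only edges in `F`. -/
def Reaches (ends : E → Sym2 V) (F : Set E) (a b : V) : Prop :=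
  Relation.ReflTransGen (Step ends F) a b

/-- The vertex set `S` is connected in the subgraph with edge set `F`. -/
def ConnectsSet (ends : E → Sym2 V) (F : Set E) (S : Set V) : Prop :=
  ∀ a ∈ S, ∀ b ∈ S, Reaches ends F a b

/-- A walk from `u` to `w` given by a list of edges. -/
inductive IsWalk (ends : E → Sym2 V) : V → V → List E → Prop
  | nil (v : V) : IsWalk ends v v []
  | cons {u v w : V} {e : E} {l : List E} :
      ends e = s(u, v) → IsWalk ends v w l → IsWalk ends u w (e :: l)

/-- A path from `u` to `v` using edges of `F` (a walk with no repeated edges). -/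
def IsPathIn (ends : E → Sym2 V) (F : Set E) (u v : V) (l : List E) : Prop :=
  IsWalk ends u v l ∧ l.Nodup ∧ ∀ e ∈ l, e ∈ F

/-- There are `n` pairwise edge-disjoint paths from `u` to `v` inside `F`. -/
def EdgeDisjointPathsIn (ends : E → Sym2 V) (F : Set E) (n : ℕ) (u v : V) : Prop :=
  ∃ P : Fin n → List E, (∀ i, IsPathIn ends F u v (P i)) ∧
    ∀ i j, i ≠ j → ∀ e ∈ P i, e ∉ P j

/-- `S` is `n`-edge-connected in the (sub)graph with edge set `F`:
any two distinct vertices of `S` are joined by `n` edge-disjoint paths. -/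
def EdgeConnectedIn (ends : E → Sym2 V) (F : Set E) (S : Set V) (n : ℕ) : Prop :=
  ∀ a ∈ S, ∀ b ∈ S, a ≠ b → EdgeDisjointPathsIn ends F n a b

/-- A family of subgraphs (edge sets) is pairwise edge-disjoint. -/
def PairwiseEdgeDisjoint {k : ℕ} (H : Fin k → Set E) : Prop :=
  ∀ i j, i ≠ j → Disjoint (H i) (H j)

/-- `v` is a cut vertex of the subgraph with edge set `H`: some two vertices
distinct from `v` are connected in `H` but not after removing `v`. -/
def IsCutVertexOf (ends : E → Sym2 V) (H : Set E) (v : V) : Prop :=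
  ∃ a b : V, a ≠ v ∧ b ≠ v ∧ Reaches ends H a b ∧
    ¬ Reaches ends {e ∈ H | v ∉ ends e} a b

/-- A subpartition of `E(v)` into `k` (possibly empty) parts. -/
def IsSubpartitionAt {k : ℕ} (ends : E → Sym2 V) (v : V) (P : Fin k → Set E) : Prop :=
  (∀ i, P i ⊆ incEdges ends v) ∧ ∀ i j, i ≠ j → Disjoint (P i) (P j)

/-- A balanced partition of `E(v)` into `k` parts: each part has ≥ 2 edges. -/
def IsBalancedPartitionAt {k : ℕ} (ends : E → Sym2 V) (v : V) (P : Fin k → Set E) : Prop :=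
  IsSubpartitionAt ends v P ∧ (⋃ i, P i) = incEdges ends v ∧ ∀ i, 2 ≤ (P i).ncard

/-- A balanced subpartition of `E(v)`: one extendable to a balanced partition. -/
def IsBalancedSubpartitionAt {k : ℕ} (ends : E → Sym2 V) (v : V) (P : Fin k → Set E) : Prop :=
  IsSubpartitionAt ends v P ∧
    ∃ P' : Fin k → Set E, IsBalancedPartitionAt ends v P' ∧ ∀ i, P i ⊆ P' i

/-- The subgraphs `H 1, …, H k` extend the subpartition `P` at `v`:
`P i ⊆ H i` and `v` is not a cut vertex of any `H i`. -/
def Extend {k : ℕ} (ends : E → Sym2 V) (v : V) (P H : Fin k → Set E) : Prop :=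
  ∀ i, P i ⊆ H i ∧ ¬ IsCutVertexOf ends (H i) v

/-- The subgraphs `H 1, …, H k` balance the vertex `u`. -/
def BalanceVertex {k : ℕ} (ends : E → Sym2 V) (H : Fin k → Set E) (u : V) : Prop :=
  IsBalancedSubpartitionAt ends u (fun i => incEdges ends u ∩ H i)

/-- The subgraphs `H 1, …, H k` balance every vertex of `T`. -/
def BalanceSet {k : ℕ} (ends : E → Sym2 V) (H : Fin k → Set E) (T : Set V) : Prop :=
  ∀ u ∈ T, BalanceVertex ends H u

/-- A loopless multigraph. -/
def Loopless (ends : E → Sym2 V) : Prop := ∀ e : E, ¬ (ends e).IsDiag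

/-- The set of neighbors of a vertex. -/
def neighbors (ends : E → Sym2 V) (u : V) : Set V := {w | ∃ e, ends e = s(u, w)}

/-- The function `f(t) = t² + 2t − 15` (so `f(3) = 0` and
`f(t) = f(t−1) + 2t + 1` for `t ≥ 4`). -/
def fBound (t : ℕ) : ℕ := t ^ 2 + 2 * t - 15

section
open Classical Finset

/-- If `dem` is supermodular and every set `A` is avoided by enough option sets, then each option
set can be shrunk to at most one option while keeping this property. -/
theorem exists_selection {I O : Type} [Fintype I] [DecidableEq O] (dem : Finset O → ℤ)
    (hsup : ∀ A B, dem A + dem B ≤ dem (A ∩ B) + dem (A ∪ B)) (n : ℕ) :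
    ∀ opts : I → Finset O, ∑ j, #(opts j) = n →
      (∀ A, dem A ≤ #{j | ¬ opts j ⊆ A}) →
      ∃ sel : I → Finset O, (∀ j, sel j ⊆ opts j) ∧ (∀ j, #(sel j) ≤ 1) ∧
        ∀ A, dem A ≤ #{j | ¬ sel j ⊆ A} := by
  induction n using Nat.strong_induction_on with
  | _ n ih =>
  intro opts hn hopts
  by_cases hall : ∀ j, #(opts j) ≤ 1
  · exact ⟨opts, fun j => Subset.rfl, hall, hopts⟩
  push Not at hall
  obtain ⟨j, hj⟩ := hall
  obtain ⟨o₁, ho₁, o₂, ho₂, hne⟩ := one_lt_card.1 hj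
  have key : ∀ o ∈ opts j,
      (∃ sel : I → Finset O, (∀ j, sel j ⊆ opts j) ∧ (∀ j, #(sel j) ≤ 1) ∧
        ∀ A, dem A ≤ #{j | ¬ sel j ⊆ A}) ∨
      ∃ A, (#{j | ¬ opts j ⊆ A} : ℤ) ≤ dem A ∧ o ∉ A ∧ (opts j).erase o ⊆ A := by
    intro o ho
    set opts' := Function.update opts j ((opts j).erase o) with hopts'
    have hsub : ∀ i, opts' i ⊆ opts i := by
      intro i
      by_cases hij : i = j
      · subst hij; simp [hopts', erase_subset]
      · simp [hopts', hij]
    by_cases h : ∀ A, dem A ≤ #{j | ¬ opts' j ⊆ A}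
    · left
      have hlt : ∑ i, #(opts' i) < n := by
        rw [← hn]
        refine sum_lt_sum (fun i _ => card_le_card (hsub i)) ⟨j, mem_univ _, ?_⟩
        simp only [hopts', Function.update_self]
        exact card_erase_lt_of_mem ho
      obtain ⟨sel, h1, h2, h3⟩ := ih _ hlt opts' rfl h
      exact ⟨sel, fun i => (h1 i).trans (hsub i), h2, h3⟩
    · right
      push Not at h
      obtain ⟨A, hA⟩ := h
      have hA' := hopts A
      have hle : #{j | ¬ opts j ⊆ A} ≤ #{j | ¬ opts' j ⊆ A} + 1 := by
        refine (card_le_card (t := insert j ({j | ¬ opts' j ⊆ A} : Finset I)) ?_).trans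
          (card_insert_le _ _)
        intro i hi
        by_cases hij : i = j
        · simp [hij]
        · simpa [hopts', hij] using hi
      have hsubA : (opts j).erase o ⊆ A := by
        by_contra hcon
        have : #{j | ¬ opts j ⊆ A} ≤ #{j | ¬ opts' j ⊆ A} := by
          refine card_le_card ?_
          intro i hi
          by_cases hij : i = j
          · subst hij; simpa [hopts'] using hcon
          · simpa [hopts', hij] using hi
        omega
      refine ⟨A, by omega, ?_, hsubA⟩
      intro hoA
      have hj' : opts j ⊆ A := by
        intro x hx
        by_cases hxo : x = o
        · exact hxo ▸ hoA
        · exact hsubA (mem_erase.2 ⟨hxo, hx⟩)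
      have : #{j | ¬ opts j ⊆ A} ≤ #{j | ¬ opts' j ⊆ A} := by
        refine card_le_card ?_
        intro i hi
        by_cases hij : i = j
        · subst hij; simp [hj'] at hi
        · simpa [hopts', hij] using hi
      omega
  rcases key o₁ ho₁ with h | ⟨A, hA, hoA, hsA⟩
  · exact h
  rcases key o₂ ho₂ with h | ⟨B, hB, hoB, hsB⟩
  · exact h
  exfalso
  have h1 := hopts (A ∩ B)
  have h2 := hopts (A ∪ B)
  have h3 := hsup A B
  have hlt : #{j | ¬ opts j ⊆ A ∩ B} + #{j | ¬ opts j ⊆ A ∪ B}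
      < #{j | ¬ opts j ⊆ A} + #{j | ¬ opts j ⊆ B} := by
    simp only [card_filter, ← sum_add_distrib]
    refine sum_lt_sum ?_ ⟨j, mem_univ _, ?_⟩
    · intro i _
      have e1 : opts i ⊆ A ∩ B ↔ opts i ⊆ A ∧ opts i ⊆ B := subset_inter_iff
      have e2 : opts i ⊆ A → opts i ⊆ A ∪ B := fun h => h.trans subset_union_left
      have e3 : opts i ⊆ B → opts i ⊆ A ∪ B := fun h => h.trans subset_union_right
      by_cases a1 : opts i ⊆ A <;> by_cases a2 : opts i ⊆ B <;> simp [e1, a1, a2, e2, e3]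
      split_ifs <;> omega
    · have a1 : ¬ opts j ⊆ A := fun h => hoA (h ho₁)
      have a2 : ¬ opts j ⊆ B := fun h => hoB (h ho₂)
      have a3 : opts j ⊆ A ∪ B := by
        intro x hx
        by_cases hxo : x = o₁
        · exact mem_union_right _ (hsB (mem_erase.2 ⟨hxo ▸ hne, hx⟩))
        · exact mem_union_left _ (hsA (mem_erase.2 ⟨hxo, hx⟩))
      simp only [a1, a2, a3, not_true, not_false_eq_true, if_true, if_false]
      split_ifs <;> omega
  have : ((#{j | ¬ opts j ⊆ A ∩ B} + #{j | ¬ opts j ⊆ A ∪ B} : ℕ) : ℤ)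
      < ((#{j | ¬ opts j ⊆ A} + #{j | ¬ opts j ⊆ B} : ℕ) : ℤ) := by exact_mod_cast hlt
  push_cast at this
  omega

/-- The arithmetic behind the partition inequality for hypergraph packings. -/
theorem demand_le {k Q m h c l g b p r : ℤ} (hk : 0 < k) (hQ : 7 * k ≤ Q) (hm : 1 ≤ m)
    (hh : 0 ≤ h) (hg : 0 ≤ g) (hcl : c + l ≤ Q)
    (hsum : m * Q ≤ min 3 m * h + 2 * c + l) (hbk : b ≤ k) (hb : 2 * b ≤ l + g)
    (hp : 0 ≤ p) (hpm : p ≤ m) (hr : r ≤ k * p)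
    (hfew : m ≤ p + 1 → g = c) (hall : m = p → 2 * r ≤ 2 * (k * (m - 1)) + g) :
    (m = 1 → r ≤ h + g) ∧ (2 ≤ m → k * (m - 2) + b + r ≤ h + g) := by
  refine ⟨?_, ?_⟩
  · rintro rfl
    rcases eq_or_lt_of_le hp with rfl | hp1
    · simp at hr; linarith
    · have : (1 : ℤ) = p := by omega
      have := hall this
      omega
  · intro hm2
    rcases eq_or_lt_of_le hm2 with rfl | hm3
    · rw [min_eq_right (by norm_num)] at hsum
      rcases eq_or_lt_of_le hp with rfl | hp1
      · simp at hr; linarith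
      · have hgc := hfew (by omega)
        have : k * p ≤ k * 2 := by nlinarith
        linarith
    · rw [min_eq_left (by omega)] at hsum
      have hkm : k * (m - 1) = k * (m - 2) + k := by ring
      have hmQ : m * Q = (m - 2) * Q + 2 * Q := by ring
      have hge : 7 * (k * (m - 2)) ≤ (m - 2) * Q := by nlinarith
      have hk1 : k ≤ k * (m - 2) := by nlinarith
      by_cases hs : m ≤ p + 1
      · have hgc := hfew hs
        have hr' : 2 * r ≤ 2 * (k * (m - 1)) + g := by
          rcases eq_or_lt_of_le hpm with rfl | hlt
          · exact hall rfl
          · have : p = m - 1 := by omega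
            subst this; linarith
        linarith
      · have : k * p ≤ k * (m - 2) := by nlinarith
        linarith
end

section
open Classical Finset

/-- The ways in which the hyperedge `N j` may be used: as an edge `a b` of the `i`-th forest, or
as a reserve at the vertex `x`. -/
noncomputable def options {V I : Type} [Fintype V] {k : ℕ} (v : V) (N : I → Finset V)
    (c : I → Fin k) (j : I) : Finset ((Fin k × V × V) ⊕ V) :=
  univ.filter fun o => match o with
    | .inl (i, a, b) => a ∈ N j ∧ b ∈ N j ∧ a ≠ v ∧ b ≠ v ∧ (v ∈ N j → i = c j)
    | .inr x => x ∈ N j ∧ x ≠ v ∧ (v ∈ N j → #(N j) = 3)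

/-- The functions supported on `U` that take equal values at `a` and `b` whenever the `i`-th edge
`a b` is present in `A`. -/
def potentials {V : Type} {k : ℕ} (U : Finset V) (A : Finset ((Fin k × V × V) ⊕ V)) (i : Fin k) :
    Submodule ℚ (V → ℚ) where
  carrier := {f | (∀ x, x ∉ U → f x = 0) ∧ ∀ a b, Sum.inl (i, a, b) ∈ A → f a = f b}
  add_mem' := by
    rintro f g ⟨hf, hf'⟩ ⟨hg, hg'⟩
    refine ⟨fun x hx => by simp [hf x hx, hg x hx], fun a b h => ?_⟩
    simp [hf' a b h, hg' a b h]
  zero_mem' := by simp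
  smul_mem' := by
    rintro q f ⟨hf, hf'⟩
    refine ⟨fun x hx => by simp [hf x hx], fun a b h => ?_⟩
    simp [hf' a b h]

theorem mem_potentials {V : Type} {k : ℕ} {U : Finset V} {A : Finset ((Fin k × V × V) ⊕ V)}
    {i : Fin k} {f : V → ℚ} : f ∈ potentials U A i ↔
      (∀ x, x ∉ U → f x = 0) ∧ ∀ a b, Sum.inl (i, a, b) ∈ A → f a = f b := Iff.rfl

/-- The number of hyperedges that have to be used outside the set of options `A`. -/
noncomputable def demand {V : Type} {k : ℕ} (U : Finset V) (r : V → ℕ)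
    (A : Finset ((Fin k × V × V) ⊕ V)) : ℤ :=
  ∑ i, ((Module.finrank ℚ (potentials U A i) : ℤ) - 1) +
    ∑ x ∈ U, if Sum.inr x ∈ A then (0 : ℤ) else r x

theorem demand_supermodular {V : Type} [Fintype V] {k : ℕ} (U : Finset V) (r : V → ℕ)
    (A B : Finset ((Fin k × V × V) ⊕ V)) :
    demand U r A + demand U r B ≤ demand U r (A ∩ B) + demand U r (A ∪ B) := by
  have h1 : ∀ i, (Module.finrank ℚ (potentials U A i) : ℤ) - 1
      + ((Module.finrank ℚ (potentials U B i) : ℤ) - 1) ≤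
      (Module.finrank ℚ (potentials U (A ∩ B) i) : ℤ) - 1
      + ((Module.finrank ℚ (potentials U (A ∪ B) i) : ℤ) - 1) := by
    intro i
    have e1 : potentials U (A ∪ B) i = potentials U A i ⊓ potentials U B i := by
      ext f
      simp only [Submodule.mem_inf, mem_potentials, mem_union]
      refine ⟨fun h => ⟨⟨h.1, fun a b hab => h.2 a b (Or.inl hab)⟩,
        ⟨h.1, fun a b hab => h.2 a b (Or.inr hab)⟩⟩, fun h => ⟨h.1.1, fun a b hab => ?_⟩⟩
      exact hab.elim (h.1.2 a b) (h.2.2 a b)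
    have e2 : potentials U A i ⊔ potentials U B i ≤ potentials U (A ∩ B) i := by
      refine sup_le ?_ ?_
      · exact fun f hf => ⟨hf.1, fun a b hab => hf.2 a b (mem_inter.1 hab).1⟩
      · exact fun f hf => ⟨hf.1, fun a b hab => hf.2 a b (mem_inter.1 hab).2⟩
    have e3 := Submodule.finrank_mono e2
    have e4 := Submodule.finrank_sup_add_finrank_inf_eq (potentials U A i) (potentials U B i)
    rw [← e1] at e4
    omega
  have h2 : ∀ x : V, (if Sum.inr x ∈ A then (0 : ℤ) else r x)
      + (if Sum.inr x ∈ B then (0 : ℤ) else r x) =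
      (if Sum.inr x ∈ A ∩ B then (0 : ℤ) else r x)
      + (if Sum.inr x ∈ A ∪ B then (0 : ℤ) else r x) := by
    intro x
    by_cases a : Sum.inr x ∈ A <;> by_cases b : Sum.inr x ∈ B <;> simp [a, b]
  have h3 := sum_le_sum fun i (_ : i ∈ (univ : Finset (Fin k))) => h1 i
  have h4 := sum_congr (rfl : U = U) fun x _ => h2 x
  simp only [sum_add_distrib] at h3 h4
  unfold demand
  linarith

theorem finrank_le_of_eq_zero {V : Type} [Fintype V] (W : Submodule ℚ (V → ℚ)) (K : Finset V)
    (h : ∀ f ∈ W, (∀ x ∈ K, f x = 0) → f = 0) : Module.finrank ℚ W ≤ #K := by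
  let φ : W →ₗ[ℚ] (K → ℚ) := (LinearMap.funLeft ℚ ℚ (fun x : K => (x : V))).comp W.subtype
  have hφ : Function.Injective φ := by
    rw [← LinearMap.ker_eq_bot, LinearMap.ker_eq_bot']
    intro f hf
    refine Subtype.ext (h f f.2 fun x hx => ?_)
    exact congrFun hf ⟨x, hx⟩
  have := LinearMap.finrank_le_finrank_of_injective hφ
  simpa using this

/-- The partition of the vertices generated by making the given hyperedges monochromatic, together
with a choice of representatives. -/
theorem exists_representatives {V I : Type} (J : I → Prop) (N : I → Finset V) :
    ∃ rep : V → V, (∀ j, J j → ∀ a ∈ N j, ∀ b ∈ N j, rep a = rep b) ∧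
      ∀ f : V → ℚ, (∀ j, J j → ∀ a ∈ N j, ∀ b ∈ N j, f a = f b) →
        (∀ x, f (rep x) = f x) ∧ ∀ x y, rep x = rep y → f x = f y := by
  let s : Setoid V :=
    { r := fun x y => ∀ f : V → ℚ, (∀ j, J j → ∀ a ∈ N j, ∀ b ∈ N j, f a = f b) → f x = f y
      iseqv := ⟨fun _ _ _ => rfl, fun h f hf => (h f hf).symm,
        fun h1 h2 f hf => (h1 f hf).trans (h2 f hf)⟩ }
  have hout : ∀ x : V, s.r (Quotient.mk s x).out x := fun x => Quotient.exact (Quotient.out_eq _)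
  refine ⟨fun x => (Quotient.mk s x).out, fun j hj a ha b hb => ?_, fun f hf => ⟨fun x => ?_, ?_⟩⟩
  · refine congrArg Quotient.out (Quotient.sound ?_)
    exact fun f hf => hf j hj a ha b hb
  · exact hout x f hf
  · intro x y hxy
    have h1 := hout x f hf
    have h2 := hout y f hf
    simp only at hxy
    rw [← h1, ← h2, hxy]

end

section
open Classical Finset

/-- Double counting of the hyperedges that cross the classes of a partition of `S \ {v}`. -/
theorem card_mul_le_crossing {V I : Type} [Fintype I] {Q : ℕ} (S : Finset V) (v : V)
    (hv : v ∈ S) (N : I → Finset V) (hN : ∀ j, N j ⊆ S) (hN3 : ∀ j, #(N j) ≤ 3)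
    (hcut : ∀ Z ⊆ S, Z.Nonempty → Z ≠ S → Q ≤ #{j | (N j ∩ Z).Nonempty ∧ ¬ N j ⊆ Z})
    (rep : V → V) :
    #((S.erase v).image rep) * Q ≤ min 3 #((S.erase v).image rep) *
        #{j | v ∉ N j ∧ ∃ a ∈ N j, ∃ b ∈ N j, a ≠ v ∧ b ≠ v ∧ rep a ≠ rep b}
      + 2 * #{j | v ∈ N j ∧ ∃ a ∈ N j, ∃ b ∈ N j, a ≠ v ∧ b ≠ v ∧ rep a ≠ rep b}
      + #{j | v ∈ N j ∧ ¬ ∃ a ∈ N j, ∃ b ∈ N j, a ≠ v ∧ b ≠ v ∧ rep a ≠ rep b} := by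
  set K := (S.erase v).image rep with hK
  set Z : V → Finset V := fun κ => (S.erase v).filter (fun x => rep x = κ) with hZ
  have hZmem : ∀ x κ, x ∈ Z κ ↔ (x ≠ v ∧ x ∈ S) ∧ rep x = κ := by
    intro x κ; simp [hZ]
  have h1 : ∀ κ ∈ K, Q ≤ #{j | (N j ∩ Z κ).Nonempty ∧ ¬ N j ⊆ Z κ} := by
    intro κ hκ
    obtain ⟨x, hx, hxκ⟩ := mem_image.1 hκ
    have hx' := mem_erase.1 hx
    refine hcut _ ?_ ⟨x, (hZmem _ _).2 ⟨hx', hxκ⟩⟩ ?_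
    · intro y hy; exact ((hZmem _ _).1 hy).1.2
    · intro h
      rw [← h] at hv
      exact ((hZmem _ _).1 hv).1.1 rfl
  have h2 : #K * Q ≤ ∑ κ ∈ K, #{j | (N j ∩ Z κ).Nonempty ∧ ¬ N j ⊆ Z κ} := by
    have := sum_le_sum h1
    simpa using this
  have h3 : ∑ κ ∈ K, #{j | (N j ∩ Z κ).Nonempty ∧ ¬ N j ⊆ Z κ}
      = ∑ j, #{κ ∈ K | (N j ∩ Z κ).Nonempty ∧ ¬ N j ⊆ Z κ} := by
    simp only [card_filter]
    exact sum_comm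
  have himg : ∀ j, ({κ ∈ K | (N j ∩ Z κ).Nonempty ∧ ¬ N j ⊆ Z κ} : Finset V)
      ⊆ ((N j).erase v).image rep := by
    intro j κ hκ
    obtain ⟨x, hx⟩ := (mem_filter.1 hκ).2.1
    have hx' := mem_inter.1 hx
    have hx2 := (hZmem _ _).1 hx'.2
    exact mem_image.2 ⟨x, mem_erase.2 ⟨hx2.1.1, hx'.1⟩, hx2.2⟩
  have h4 : ∀ j, #{κ ∈ K | (N j ∩ Z κ).Nonempty ∧ ¬ N j ⊆ Z κ} ≤
      min 3 #K * (if v ∉ N j ∧ ∃ a ∈ N j, ∃ b ∈ N j, a ≠ v ∧ b ≠ v ∧ rep a ≠ rep b then 1 else 0)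
      + 2 * (if v ∈ N j ∧ ∃ a ∈ N j, ∃ b ∈ N j, a ≠ v ∧ b ≠ v ∧ rep a ≠ rep b then 1 else 0)
      + (if v ∈ N j ∧ ¬ ∃ a ∈ N j, ∃ b ∈ N j, a ≠ v ∧ b ≠ v ∧ rep a ≠ rep b then 1 else 0) := by
    intro j
    have hle := (card_le_card (himg j)).trans card_image_le
    by_cases hvj : v ∈ N j <;>
      by_cases hnc : ∃ a ∈ N j, ∃ b ∈ N j, a ≠ v ∧ b ≠ v ∧ rep a ≠ rep b
    · have := card_erase_of_mem hvj
      have := hN3 j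
      simp only [hvj, hnc]
      simp
      omega
    · simp only [hvj, hnc]
      simp only [not_true_eq_false, and_false, if_false, mul_zero, and_true, zero_add,
        not_false_eq_true, if_true]
      refine (card_le_card (himg j)).trans (card_le_one.2 ?_)
      intro p hp q hq
      obtain ⟨a, ha, rfl⟩ := mem_image.1 hp
      obtain ⟨b, hb, rfl⟩ := mem_image.1 hq
      by_contra hne
      exact hnc ⟨a, (mem_erase.1 ha).2, b, (mem_erase.1 hb).2, (mem_erase.1 ha).1,
        (mem_erase.1 hb).1, hne⟩
    · have h5 : #{κ ∈ K | (N j ∩ Z κ).Nonempty ∧ ¬ N j ⊆ Z κ} ≤ #K := card_filter_le _ _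
      have := hN3 j
      have h6 := card_le_card (erase_subset v (N j))
      simp only [hvj, hnc]
      simp
      omega
    · have h5 : ({κ ∈ K | (N j ∩ Z κ).Nonempty ∧ ¬ N j ⊆ Z κ} : Finset V) = ∅ := by
        rw [filter_eq_empty_iff]
        rintro κ - ⟨⟨x, hx⟩, hnot⟩
        refine hnot fun y hy => ?_
        have hx' := mem_inter.1 hx
        have hx2 := (hZmem _ _).1 hx'.2
        have hyv : y ≠ v := fun h => hvj (h ▸ hy)
        refine (hZmem _ _).2 ⟨⟨hyv, hN j hy⟩, ?_⟩
        by_contra hne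
        exact hnc ⟨x, hx'.1, y, hy, hx2.1.1, hyv, fun h => hne (h ▸ hx2.2)⟩
      rw [h5]; simp
  refine h2.trans (h3.le.trans ((sum_le_sum fun j _ => h4 j).trans ?_))
  simp only [sum_add_distrib, ← mul_sum, card_filter]
  exact le_rfl

end

section
open Classical Finset

set_option maxHeartbeats 800000 in
/-- The set of options `options v N c` leaves enough hyperedges to meet every demand. -/
theorem demand_le_card {V I : Type} [Fintype V] [Fintype I] {k Q : ℕ} (hk : 0 < k)
    (hQ : 7 * k ≤ Q) (S : Finset V) (v : V) (hv : v ∈ S) (hS : ∃ s ∈ S, s ≠ v)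
    (N : I → Finset V) (hN : ∀ j, N j ⊆ S) (hN3 : ∀ j, #(N j) ≤ 3) (hN1 : ∀ j, #(N j) ≠ 1)
    (c : I → Fin k)
    (hcut : ∀ Z ⊆ S, Z.Nonempty → Z ≠ S → Q ≤ #{j | (N j ∩ Z).Nonempty ∧ ¬ N j ⊆ Z})
    (hdeg : #{j | v ∈ N j} ≤ Q) (htwo : ∀ i, 2 ≤ #{j | v ∈ N j ∧ c j = i})
    (A : Finset ((Fin k × V × V) ⊕ V)) :
    demand (S.erase v) (fun x => #{i | ¬ ∃ j, N j = {v, x} ∧ c j = i}) A ≤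
      #{j | ¬ options v N c j ⊆ A} := by
  set U := S.erase v with hU
  set r : V → ℕ := fun x => #{i : Fin k | ¬ ∃ j, N j = {v, x} ∧ c j = i} with hr
  obtain ⟨rep, hrep1, hrep2⟩ := exists_representatives
    (fun j => options v N c j ⊆ A ∧ v ∉ N j) N
  have hdouble := card_mul_le_crossing S v hv N hN hN3 hcut rep
  set nc : I → Prop := fun j => ∃ a ∈ N j, ∃ b ∈ N j, a ≠ v ∧ b ≠ v ∧ rep a ≠ rep b with hnc
  set K := U.image rep with hK
  change #K * Q ≤ min 3 #K * #{j | v ∉ N j ∧ nc j} + 2 * #{j | v ∈ N j ∧ nc j}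
      + #{j | v ∈ N j ∧ ¬ nc j} at hdouble
  have memU : ∀ {j x}, x ∈ N j → x ≠ v → x ∈ U := fun hx hxv => mem_erase.2 ⟨hxv, hN _ hx⟩
  have optl : ∀ {j i a b}, options v N c j ⊆ A → a ∈ N j → b ∈ N j → a ≠ v → b ≠ v →
      (v ∈ N j → i = c j) → (Sum.inl (i, a, b) : (Fin k × V × V) ⊕ V) ∈ A := by
    intro j i a b hj ha hb hav hbv hi
    exact hj (mem_filter.2 ⟨mem_univ _, ha, hb, hav, hbv, hi⟩)
  have optr : ∀ {j x}, options v N c j ⊆ A → x ∈ N j → x ≠ v → (v ∈ N j → #(N j) = 3) →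
      (Sum.inr x : (Fin k × V × V) ⊕ V) ∈ A := by
    intro j x hj hx hxv hi
    exact hj (mem_filter.2 ⟨mem_univ _, hx, hxv, hi⟩)
  have hconst : ∀ {i f}, f ∈ potentials U A i → (∀ x, f (rep x) = f x) ∧
      ∀ x y, rep x = rep y → f x = f y := by
    intro i f hf
    refine hrep2 f ?_
    rintro j ⟨hj, hvj⟩ a ha b hb
    exact hf.2 a b (optl hj ha hb (fun h => hvj (h ▸ ha)) (fun h => hvj (h ▸ hb))
      (fun h => absurd h hvj))
  have hzero : ∀ {i f}, f ∈ potentials U A i → (∀ κ ∈ K, f κ = 0) → f = 0 := by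
    intro i f hf h0
    funext x
    by_cases hx : x ∈ U
    · rw [← (hconst hf).1 x]; exact h0 _ (mem_image_of_mem _ hx)
    · exact hf.1 x hx
  have hdim : ∀ i, Module.finrank ℚ (potentials U A i) ≤ #K := fun i =>
    finrank_le_of_eq_zero _ _ fun f hf h0 => hzero hf h0
  have hdim' : ∀ i, (∃ j, options v N c j ⊆ A ∧ v ∈ N j ∧ nc j ∧ c j = i) →
      Module.finrank ℚ (potentials U A i) + 1 ≤ #K := by
    rintro i ⟨j, hj, hvj, ⟨a, ha, b, hb, hav, hbv, hab⟩, hc⟩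
    have hbK : rep b ∈ K := mem_image_of_mem _ (memU hb hbv)
    have haK : rep a ∈ K := mem_image_of_mem _ (memU ha hav)
    have := finrank_le_of_eq_zero (potentials U A i) (K.erase (rep b)) ?_
    · rw [card_erase_of_mem hbK] at this
      have := card_pos.2 ⟨_, hbK⟩
      omega
    · intro f hf h0
      refine hzero hf fun κ hκ => ?_
      by_cases hκb : κ = rep b
      · rw [hκb, (hconst hf).1 b, ← hf.2 a b (optl hj ha hb hav hbv fun _ => hc.symm),
          ← (hconst hf).1 a]
        exact h0 _ (mem_erase.2 ⟨hab, haK⟩)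
      · exact h0 _ (mem_erase.2 ⟨hκb, hκ⟩)
  set B : Finset (Fin k) := univ.filter
    fun i => ¬ ∃ j, options v N c j ⊆ A ∧ v ∈ N j ∧ nc j ∧ c j = i with hB
  set h := #{j | v ∉ N j ∧ nc j} with hh
  set C := #{j | v ∈ N j ∧ nc j} with hC
  set l := #{j | v ∈ N j ∧ ¬ nc j} with hl
  set g := #{j | v ∈ N j ∧ nc j ∧ ¬ options v N c j ⊆ A} with hg
  have hm1 : 1 ≤ #K := by
    obtain ⟨s, hs, hsv⟩ := hS
    exact card_pos.2 ⟨_, mem_image_of_mem rep (mem_erase.2 ⟨hsv, hs⟩)⟩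
  have hcl : C + l ≤ Q := by
    refine le_trans (le_of_eq ?_) hdeg
    rw [hC, hl, ← filter_filter, ← filter_filter]
    exact card_filter_add_card_filter_not _
  have hbk : #B ≤ k := by simpa using card_filter_le (univ : Finset (Fin k)) _
  have h2b : 2 * #B ≤ l + g := by
    have e1 : ∀ i ∈ B, 2 ≤ #{j ∈ ({j | v ∈ N j ∧ ¬ (nc j ∧ options v N c j ⊆ A)} : Finset I) |
        c j = i} := by
      intro i hi
      refine (htwo i).trans (card_le_card ?_)
      intro j hj
      simp only [mem_filter, mem_univ, true_and] at hj ⊢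
      refine ⟨⟨hj.1, fun hcon => ?_⟩, hj.2⟩
      exact (mem_filter.1 hi).2 ⟨j, hcon.2, hj.1, hcon.1, hj.2⟩
    have e2 := card_nsmul_le_sum B _ 2 e1
    have e3 : ∑ i ∈ B, #{j ∈ ({j | v ∈ N j ∧ ¬ (nc j ∧ options v N c j ⊆ A)} : Finset I) |
        c j = i} ≤ #({j | v ∈ N j ∧ ¬ (nc j ∧ options v N c j ⊆ A)} : Finset I) := by
      refine (sum_le_univ_sum_of_nonneg fun i => Nat.zero_le _).trans (le_of_eq ?_)
      exact (card_eq_sum_card_fiberwise fun _ _ => mem_coe.2 (mem_univ _)).symm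
    have e4 : #({j | v ∈ N j ∧ ¬ (nc j ∧ options v N c j ⊆ A)} : Finset I) ≤ l + g := by
      refine le_trans (card_le_card ?_) (card_union_le _ _)
      intro j hj
      simp only [mem_filter, mem_univ, true_and, mem_union] at hj ⊢
      by_cases hn : nc j
      · exact Or.inr ⟨hj.1, hn, fun hs => hj.2 ⟨hn, hs⟩⟩
      · exact Or.inl ⟨hj.1, hn⟩
    simp only [smul_eq_mul] at e2
    omega
  have hhg : h + g ≤ #{j | ¬ options v N c j ⊆ A} := by
    rw [hh, hg, ← card_union_of_disjoint]
    · refine card_le_card ?_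
      intro j hj
      simp only [mem_filter, mem_univ, true_and, mem_union] at hj ⊢
      rcases hj with ⟨hvj, a, ha, b, hb, hav, hbv, hab⟩ | hj
      · exact fun hsub => hab (hrep1 j ⟨hsub, hvj⟩ a ha b hb)
      · exact hj.2.2
    · rw [disjoint_left]
      intro j hj hj'
      simp only [mem_filter, mem_univ, true_and] at hj hj'
      exact hj.1 hj'.1
  set Y : Finset V := U.filter (fun x => (Sum.inr x : (Fin k × V × V) ⊕ V) ∉ A) with hY
  have hsing : ∀ y ∈ Y, ∀ x, rep x = rep y → x = y := by
    intro y hy x hxy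
    obtain ⟨hyU, hyA⟩ := mem_filter.1 hy
    have := (hrep2 (fun z => if z = y then 1 else 0) ?_).2 x y hxy
    · by_contra hne
      simp [hne] at this
    · rintro j ⟨hj, hvj⟩
      have hyj : y ∉ N j := fun hyj =>
        hyA (optr hj hyj (mem_erase.1 hyU).1 fun hvj' => absurd hvj' hvj)
      intro a ha b hb
      have ha' : a ≠ y := fun h => hyj (h ▸ ha)
      have hb' : b ≠ y := fun h => hyj (h ▸ hb)
      simp [ha', hb']
  have hYimg : Y.image rep ⊆ K := image_subset_image (filter_subset _ _)
  have hYcard : #(Y.image rep) = #Y :=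
    card_image_of_injOn fun x hx y hy hxy => hsing y hy x hxy
  have hpm : #Y ≤ #K := hYcard ▸ card_le_card hYimg
  have hrk : ∀ x, r x ≤ k := fun x => by simpa using card_filter_le (univ : Finset (Fin k)) _
  have hR : ∑ x ∈ Y, r x ≤ k * #Y := by
    have := sum_le_card_nsmul Y r k fun x _ => hrk x
    rwa [smul_eq_mul, mul_comm] at this
  have hcard3 : ∀ {j a b}, v ∈ N j → a ∈ N j → b ∈ N j → a ≠ v → b ≠ v → a ≠ b →
      #(N j) = 3 := by
    intro j a b hvj ha hb hav hbv hab
    refine le_antisymm (hN3 j) ?_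
    have : ({v, a, b} : Finset V) ⊆ N j := by
      intro z hz
      simp only [mem_insert, mem_singleton] at hz
      rcases hz with rfl | rfl | rfl <;> assumption
    refine le_trans (le_of_eq ?_) (card_le_card this)
    rw [card_eq_three.2 ⟨v, a, b, hav.symm, hbv.symm, hab, rfl⟩]
  have hfew : #K ≤ #Y + 1 → g = C := by
    intro hKY
    refine congrArg card (filter_congr fun j _ => ⟨fun h => ⟨h.1, h.2.1⟩, fun h => ⟨h.1, h.2, ?_⟩⟩)
    obtain ⟨hvj, a, ha, b, hb, hav, hbv, hab⟩ := h
    intro hj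
    have h3 := hcard3 hvj ha hb hav hbv fun h => hab (h ▸ rfl)
    have hnotY : ∀ x ∈ N j, x ≠ v → rep x ∉ Y.image rep := by
      intro x hx hxv hmem
      obtain ⟨y, hy, hyx⟩ := mem_image.1 hmem
      have := hsing y hy x hyx.symm
      subst this
      exact (mem_filter.1 hy).2 (optr hj hx hxv fun _ => h3)
    have hsub : insert (rep a) (insert (rep b) (Y.image rep)) ⊆ K := by
      intro z hz
      simp only [mem_insert] at hz
      rcases hz with rfl | rfl | hz
      · exact mem_image_of_mem _ (memU ha hav)
      · exact mem_image_of_mem _ (memU hb hbv)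
      · exact hYimg hz
    have := card_le_card hsub
    rw [card_insert_of_notMem, card_insert_of_notMem (hnotY b hb hbv), hYcard] at this
    · omega
    · simp only [mem_insert, not_or]
      exact ⟨hab, hnotY a ha hav⟩
  have hall : #K = #Y → 2 * ∑ x ∈ Y, r x ≤ 2 * (k * (#K - 1)) + g := by
    intro hKY
    have himg : Y.image rep = K := eq_of_subset_of_card_le hYimg (by omega)
    have hUY : ∀ x ∈ U, x ∈ Y := by
      intro x hx
      have : rep x ∈ Y.image rep := himg ▸ mem_image_of_mem _ hx
      obtain ⟨y, hy, hyx⟩ := mem_image.1 this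
      exact (hsing y hy x hyx.symm) ▸ hy
    set D : Finset (Fin k) := univ.filter
      fun i => ¬ ∃ x ∈ U, ∃ j, N j = {v, x} ∧ c j = i with hD
    have e1 : ∑ x ∈ Y, r x = ∑ i, #{x ∈ Y | ¬ ∃ j, N j = {v, x} ∧ c j = i} := by
      simp only [hr, card_filter]
      exact sum_comm
    have e2 : ∀ i, #{x ∈ Y | ¬ ∃ j, N j = {v, x} ∧ c j = i} ≤
        (#K - 1) + if i ∈ D then 1 else 0 := by
      intro i
      by_cases hi : i ∈ D
      · have : #{x ∈ Y | ¬ ∃ j, N j = {v, x} ∧ c j = i} ≤ #Y := card_filter_le _ _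
        simp only [hi, if_true]
        omega
      · simp only [hi, if_false, add_zero, hKY]
        simp only [hD, mem_filter, mem_univ, true_and, not_not] at hi
        obtain ⟨x, hx, hxj⟩ := hi
        rw [← card_erase_of_mem (hUY x hx)]
        refine card_le_card fun z hz => ?_
        obtain ⟨hz1, hz2⟩ := mem_filter.1 hz
        exact mem_erase.2 ⟨fun h => hz2 (h ▸ hxj), hz1⟩
    have e3 : ∑ x ∈ Y, r x ≤ k * (#K - 1) + #D := by
      rw [e1]
      refine (sum_le_sum fun i _ => e2 i).trans (le_of_eq ?_)
      rw [sum_add_distrib, ← card_filter]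
      simp
    have e4 : ∀ i ∈ D, 2 ≤ #{j ∈ ({j | v ∈ N j ∧ nc j} : Finset I) | c j = i} := by
      intro i hi
      refine (htwo i).trans (card_le_card ?_)
      intro j hj
      simp only [mem_filter, mem_univ, true_and] at hj ⊢
      refine ⟨⟨hj.1, ?_⟩, hj.2⟩
      have hi' := (mem_filter.1 hi).2
      have hc1 : 1 < #(N j) := by
        have := card_pos.2 ⟨_, hj.1⟩
        have := hN1 j
        omega
      obtain ⟨a, ha, hav⟩ := exists_mem_ne hc1 v
      have hne : N j ≠ {v, a} := fun h => hi' ⟨a, memU ha hav, j, h, hj.2⟩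
      have : ∃ b ∈ N j, b ∉ ({v, a} : Finset V) := by
        by_contra hcon
        push Not at hcon
        refine hne (Subset.antisymm hcon ?_)
        intro z hz
        simp only [mem_insert, mem_singleton] at hz
        rcases hz with rfl | rfl
        · exact hj.1
        · exact ha
      obtain ⟨b, hb, hb'⟩ := this
      simp only [mem_insert, mem_singleton, not_or] at hb'
      refine ⟨a, ha, b, hb, hav, hb'.1, fun hab => ?_⟩
      exact hb'.2 (hsing a (hUY a (memU ha hav)) b hab.symm)
    have e5 := card_nsmul_le_sum D _ 2 e4
    have e6 : ∑ i ∈ D, #{j ∈ ({j | v ∈ N j ∧ nc j} : Finset I) | c j = i} ≤ C := by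
      refine (sum_le_univ_sum_of_nonneg fun i => Nat.zero_le _).trans (le_of_eq ?_)
      exact (card_eq_sum_card_fiberwise fun _ _ => mem_coe.2 (mem_univ _)).symm
    have := hfew (by omega)
    simp only [smul_eq_mul] at e5
    omega
  have hres : ∑ x ∈ U, (if (Sum.inr x : (Fin k × V × V) ⊕ V) ∈ A then (0 : ℤ) else r x)
      = ((∑ x ∈ Y, r x : ℕ) : ℤ) := by
    rw [hY, sum_filter]
    push_cast
    refine sum_congr rfl fun x _ => ?_
    by_cases hx : (Sum.inr x : (Fin k × V × V) ⊕ V) ∈ A <;> simp [hx]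
  have hsumdim : ∑ i, ((Module.finrank ℚ (potentials U A i) : ℤ) - 1) ≤
      ∑ i, (((#K : ℤ) - 2) + if i ∈ B then 1 else 0) := by
    refine sum_le_sum fun i _ => ?_
    by_cases hi : i ∈ B
    · have := hdim i
      simp only [hi, if_true]
      omega
    · have hi' : ∃ j, options v N c j ⊆ A ∧ v ∈ N j ∧ nc j ∧ c j = i := by
        by_contra hcon
        exact hi (mem_filter.2 ⟨mem_univ _, hcon⟩)
      have := hdim' i hi'
      simp only [hi, if_false]
      omega
  have hsumdim2 : ∑ i : Fin k, (((#K : ℤ) - 2) + if i ∈ B then 1 else 0)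
      = k * ((#K : ℤ) - 2) + #B := by
    rw [sum_add_distrib]
    simp
    ring
  have hsumdim3 : ∑ i, ((Module.finrank ℚ (potentials U A i) : ℤ) - 1) ≤
      ∑ i : Fin k, ((#K : ℤ) - 1) := by
    refine sum_le_sum fun i _ => ?_
    have := hdim i
    omega
  have hall' : (#K : ℤ) = #Y →
      2 * ((∑ x ∈ Y, r x : ℕ) : ℤ) ≤ 2 * ((k : ℤ) * ((#K : ℤ) - 1)) + g := by
    intro he
    have := hall (by exact_mod_cast he)
    zify [hm1] at this
    push_cast
    linarith
  have hhg' : (h : ℤ) + g ≤ #{j | ¬ options v N c j ⊆ A} := by exact_mod_cast hhg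
  clear_value h C l g B K Y r
  have hfinal := demand_le (k := k) (Q := Q) (m := #K) (h := h) (c := C) (l := l) (g := g)
    (b := #B) (p := #Y) (r := ((∑ x ∈ Y, r x : ℕ) : ℤ)) (by exact_mod_cast hk)
    (by exact_mod_cast hQ) (by exact_mod_cast hm1) (by positivity) (by positivity)
    (by exact_mod_cast hcl) (by exact_mod_cast hdouble) (by exact_mod_cast hbk)
    (by exact_mod_cast h2b) (by positivity) (by exact_mod_cast hpm) (by exact_mod_cast hR)
    (fun he => by exact_mod_cast hfew (by exact_mod_cast he)) hall'
  unfold demand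
  rw [hres]
  by_cases hm : #K = 1
  · have := hfinal.1 (by exact_mod_cast hm)
    have h0 : ∑ i : Fin k, ((#K : ℤ) - 1) = 0 := by simp [hm]
    linarith
  · have := hfinal.2 (by exact_mod_cast (by omega : 2 ≤ #K))
    linarith

end

section
open Classical Finset

theorem one_le_finrank_potentials {V : Type} [Fintype V] {k : ℕ} (U : Finset V)
    (A : Finset ((Fin k × V × V) ⊕ V)) (i : Fin k) (hU : U.Nonempty)
    (hA : ∀ a b, Sum.inl (i, a, b) ∈ A → a ∈ U ∧ b ∈ U) :
    1 ≤ Module.finrank ℚ (potentials U A i) := by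
  obtain ⟨u, hu⟩ := hU
  have hmem : (fun z => if z ∈ U then (1 : ℚ) else 0) ∈ potentials U A i := by
    refine ⟨fun x hx => by simp [hx], fun a b hab => ?_⟩
    simp [hA a b hab]
  have : Nontrivial (potentials U A i) := by
    refine ⟨⟨_, hmem⟩, 0, fun h => ?_⟩
    have := congrFun (congrArg Subtype.val h) u
    simp [hu] at this
  exact Module.finrank_pos

theorem two_le_finrank_potentials {V : Type} [Fintype V] {k : ℕ} (U : Finset V)
    (A : Finset ((Fin k × V × V) ⊕ V)) (i : Fin k) (X : Set V) {x y : V} (hx : x ∈ U)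
    (hy : y ∈ U) (hxX : x ∈ X) (hyX : y ∉ X)
    (hA : ∀ a b, Sum.inl (i, a, b) ∈ A → a ∈ U ∧ b ∈ U ∧ (a ∈ X ↔ b ∈ X)) :
    2 ≤ Module.finrank ℚ (potentials U A i) := by
  have hmem : (fun z => if z ∈ U then (1 : ℚ) else 0) ∈ potentials U A i := by
    refine ⟨fun x hx => by simp [hx], fun a b hab => ?_⟩
    simp [hA a b hab]
  have hmem' : (fun z => if z ∈ U ∧ z ∈ X then (1 : ℚ) else 0) ∈ potentials U A i := by
    refine ⟨fun x hx => by simp [hx], fun a b hab => ?_⟩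
    simp [hA a b hab]
  by_contra hlt
  obtain ⟨f, hf⟩ := finrank_le_one_iff.1 (by omega : Module.finrank ℚ (potentials U A i) ≤ 1)
  obtain ⟨c, hc⟩ := hf ⟨_, hmem⟩
  obtain ⟨d, hd⟩ := hf ⟨_, hmem'⟩
  have h1 := congrFun (congrArg Subtype.val hc) y
  have h2 := congrFun (congrArg Subtype.val hd) y
  have h3 := congrFun (congrArg Subtype.val hd) x
  simp [hy, hyX] at h1 h2
  simp [hx, hxX] at h3
  rcases h2 with h2 | h2 <;> simp [h2] at h1 h3

/-- Packing of connectors in a hypergraph with hyperedges of size at most three, leaving enough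
unused hyperedges at each vertex. -/
theorem exists_hypergraph_packing {V I : Type} [Fintype V] [Fintype I] {k Q : ℕ} (hk : 0 < k)
    (hQ : 7 * k ≤ Q) (S : Finset V) (v : V) (hv : v ∈ S) (hS : ∃ s ∈ S, s ≠ v)
    (N : I → Finset V) (hN : ∀ j, N j ⊆ S) (hN3 : ∀ j, #(N j) ≤ 3) (hN1 : ∀ j, #(N j) ≠ 1)
    (c : I → Fin k)
    (hcut : ∀ Z ⊆ S, Z.Nonempty → Z ≠ S → Q ≤ #{j | (N j ∩ Z).Nonempty ∧ ¬ N j ⊆ Z})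
    (hdeg : #{j | v ∈ N j} ≤ Q) (htwo : ∀ i, 2 ≤ #{j | v ∈ N j ∧ c j = i}) :
    ∃ sel : I → Finset ((Fin k × V × V) ⊕ V), (∀ j, sel j ⊆ options v N c j) ∧
      (∀ j, #(sel j) ≤ 1) ∧
      (∀ (i : Fin k) (X : Set V), (∃ x ∈ S, x ≠ v ∧ x ∈ X) → (∃ y ∈ S, y ≠ v ∧ y ∉ X) →
        ∃ j a b, Sum.inl (i, a, b) ∈ sel j ∧ ¬ (a ∈ X ↔ b ∈ X)) ∧
      ∀ x ∈ S, x ≠ v →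
        #{i | ¬ ∃ j, N j = {v, x} ∧ c j = i} ≤ #{j | Sum.inr x ∈ sel j} := by
  obtain ⟨sel, h1, h2, h3⟩ := exists_selection
    (demand (S.erase v) (fun x => #{i : Fin k | ¬ ∃ j, N j = {v, x} ∧ c j = i}))
    (demand_supermodular _ _) (∑ j, #(options v N c j)) (options v N c) rfl
    (demand_le_card hk hQ S v hv hS N hN hN3 hN1 c hcut hdeg htwo)
  have hUne : (S.erase v).Nonempty := by
    obtain ⟨s, hs, hsv⟩ := hS
    exact ⟨s, mem_erase.2 ⟨hsv, hs⟩⟩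
  have hopt : ∀ {j i a b}, Sum.inl (i, a, b) ∈ sel j → a ∈ S.erase v ∧ b ∈ S.erase v := by
    intro j i a b h
    have := (mem_filter.1 (h1 j h)).2
    exact ⟨mem_erase.2 ⟨this.2.2.1, hN _ this.1⟩, mem_erase.2 ⟨this.2.2.2.1, hN _ this.2.1⟩⟩
  refine ⟨sel, h1, h2, ?_, ?_⟩
  · rintro i X ⟨x, hx, hxv, hxX⟩ ⟨y, hy, hyv, hyX⟩
    set A : Finset ((Fin k × V × V) ⊕ V) := univ.filter fun o => match o with
      | .inl (i', a, b) => a ∈ S.erase v ∧ b ∈ S.erase v ∧ (i' = i → (a ∈ X ↔ b ∈ X))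
      | .inr _ => True with hA
    have hAl : ∀ i' a b, Sum.inl (i', a, b) ∈ A ↔
        a ∈ S.erase v ∧ b ∈ S.erase v ∧ (i' = i → (a ∈ X ↔ b ∈ X)) := by
      intro i' a b
      simp only [hA, mem_filter, mem_univ, true_and]
    have hAr : ∀ z, (Sum.inr z : (Fin k × V × V) ⊕ V) ∈ A := by
      intro z
      simp only [hA, mem_filter, mem_univ, true_and]
    have hpos : 0 < #{j | ¬ sel j ⊆ A} := by
      have h := h3 A
      unfold demand at h
      have e1 : ∑ x ∈ S.erase v, (if (Sum.inr x : (Fin k × V × V) ⊕ V) ∈ A then (0 : ℤ)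
          else #{i | ¬ ∃ j, N j = {v, x} ∧ c j = i}) = 0 :=
        sum_eq_zero fun z _ => by simp [hAr z]
      have e2 : 0 < ∑ i', ((Module.finrank ℚ (potentials (S.erase v) A i') : ℤ) - 1) := by
        refine sum_pos' (fun i' _ => ?_) ⟨i, mem_univ _, ?_⟩
        · have := one_le_finrank_potentials (S.erase v) A i' hUne fun a b hab =>
            ⟨((hAl _ _ _).1 hab).1, ((hAl _ _ _).1 hab).2.1⟩
          omega
        · have := two_le_finrank_potentials (S.erase v) A i X (mem_erase.2 ⟨hxv, hx⟩)
            (mem_erase.2 ⟨hyv, hy⟩) hxX hyX fun a b hab =>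
            ⟨((hAl _ _ _).1 hab).1, ((hAl _ _ _).1 hab).2.1, ((hAl _ _ _).1 hab).2.2 rfl⟩
          omega
      have : (0 : ℤ) < #{j | ¬ sel j ⊆ A} := by
        refine lt_of_lt_of_le ?_ h
        rw [e1, add_zero]; exact e2
      exact_mod_cast this
    obtain ⟨j, hj⟩ := card_pos.1 hpos
    obtain ⟨o, ho, hoA⟩ := not_subset.1 (mem_filter.1 hj).2
    rcases o with ⟨i', a, b⟩ | z
    · have hab := hopt ho
      rw [hAl] at hoA
      have : ¬ (i' = i → (a ∈ X ↔ b ∈ X)) := fun h => hoA ⟨hab.1, hab.2, h⟩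
      push Not at this
      obtain ⟨rfl, hX⟩ := this
      refine ⟨j, a, b, ho, ?_⟩
      tauto
    · exact absurd (hAr z) hoA
  · intro x hx hxv
    set A : Finset ((Fin k × V × V) ⊕ V) := univ.filter fun o => match o with
      | .inl (_, a, b) => a ∈ S.erase v ∧ b ∈ S.erase v
      | .inr z => z ≠ x with hA
    have hAl : ∀ i' a b, Sum.inl (i', a, b) ∈ A ↔ a ∈ S.erase v ∧ b ∈ S.erase v := by
      intro i' a b
      simp only [hA, mem_filter, mem_univ, true_and]
    have hAr : ∀ z, (Sum.inr z : (Fin k × V × V) ⊕ V) ∈ A ↔ z ≠ x := by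
      intro z
      simp only [hA, mem_filter, mem_univ, true_and]
    have h := h3 A
    unfold demand at h
    have e1 : ∑ x ∈ S.erase v, (if (Sum.inr x : (Fin k × V × V) ⊕ V) ∈ A then (0 : ℤ)
          else #{i | ¬ ∃ j, N j = {v, x} ∧ c j = i}) =
          #{i | ¬ ∃ j, N j = {v, x} ∧ c j = i} := by
      rw [sum_eq_single x]
      · simp [hAr]
      · intro z _ hz
        simp [hAr, hz]
      · intro hz
        exact absurd (mem_erase.2 ⟨hxv, hx⟩) hz
    have e2 : 0 ≤ ∑ i', ((Module.finrank ℚ (potentials (S.erase v) A i') : ℤ) - 1) := by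
      refine sum_nonneg fun i' _ => ?_
      have := one_le_finrank_potentials (S.erase v) A i' hUne fun a b hab =>
            ⟨((hAl _ _ _).1 hab).1, ((hAl _ _ _).1 hab).2⟩
      omega
    have e3 : #{j | ¬ sel j ⊆ A} ≤ #{j | Sum.inr x ∈ sel j} := by
      refine card_le_card fun j hj => ?_
      obtain ⟨o, ho, hoA⟩ := not_subset.1 (mem_filter.1 hj).2
      rcases o with ⟨i', a, b⟩ | z
      · exact absurd ((hAl _ _ _).2 (hopt ho)) hoA
      · rw [hAr, not_not] at hoA
        exact mem_filter.2 ⟨mem_univ _, hoA ▸ ho⟩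
    have e4 : (#{i | ¬ ∃ j, N j = {v, x} ∧ c j = i} : ℤ) ≤ #{j | ¬ sel j ⊆ A} := by
      refine le_trans ?_ h
      refine (le_of_eq e1.symm).trans ?_
      exact le_add_of_nonneg_left e2
    exact le_trans (by exact_mod_cast e4) e3

end

section
open Classical Finset

/-- The edges of the multigraph `g` with exactly one end in `X`. -/
noncomputable def boundary {V E : Type} [Fintype E] (g : E → V × V) (X : Set V) : Finset E :=
  univ.filter fun e => ¬ ((g e).1 ∈ X ↔ (g e).2 ∈ X)

/-- The edge `e` joins `a` and `b`. -/
def Joins {V E : Type} (g : E → V × V) (e : E) (a b : V) : Prop := g e = (a, b) ∨ g e = (b, a)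

/-- Every cut separating two vertices of `S` has at least `Q` edges. -/
def CutBound {V E : Type} [Fintype E] (g : E → V × V) (S : Set V) (Q : ℕ) : Prop :=
  ∀ X : Set V, (∃ s ∈ S, s ∈ X) → (∃ s ∈ S, s ∉ X) → Q ≤ #(boundary g X)

/-- Every cut separating two vertices of `T` contains an edge of `F`. -/
def Linked {V E : Type} [Fintype E] (g : E → V × V) (F : E → Prop) (T : Set V) : Prop :=
  ∀ X : Set V, (∃ s ∈ T, s ∈ X) → (∃ s ∈ T, s ∉ X) → ∃ e ∈ boundary g X, F e

/-- The partial colouring `col` of the edges at `s` can be completed such that every colour is used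
at least twice. -/
def Balanced {V E : Type} [Fintype E] {k : ℕ} (g : E → V × V) (col : E → Option (Fin k)) (s : V) :
    Prop :=
  ∃ q : E → Fin k, (∀ e ∈ boundary g {s}, ∀ i, col e = some i → q e = i) ∧
    ∀ i, 2 ≤ #{e ∈ boundary g {s} | q e = i}

/-- The vertices of `S` and the ends of the `i`-coloured edges at `v`, except for `v` itself. -/
def terminals {V E : Type} {k : ℕ} (g : E → V × V) (S : Set V) (v : V) (pc : E → Option (Fin k))
    (i : Fin k) : Set V :=
  {x | x ≠ v ∧ (x ∈ S ∨ ∃ e, Joins g e v x ∧ pc e = some i)}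

/-- The colouring `col` agrees with `pc` at `v`, and its colour classes connect the terminals. -/
structure Extends {V E : Type} [Fintype E] {k : ℕ} (g : E → V × V) (S : Set V) (v : V)
    (pc col : E → Option (Fin k)) : Prop where
  agree : ∀ e ∈ boundary g {v}, col e = pc e
  linked : ∀ i, Linked g (fun e => col e = some i ∧ e ∉ boundary g {v}) (terminals g S v pc i)

/-- The image of a multigraph under a map of the vertices. -/
def mapEnds {V W E : Type} (π : V → W) (g : E → V × V) (e : E) : W × W :=
  (π (g e).1, π (g e).2)

/-- The map contracting `B` to the vertex `b`. -/
noncomputable def collapse {V : Type} (B : Set V) (b : V) (z : V) : V := if z ∈ B then b else z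

/-- The edges that are not loops. -/
noncomputable def properEdges {V E : Type} [Fintype E] (g : E → V × V) : Finset E :=
  univ.filter fun e => (g e).1 ≠ (g e).2

variable {V W E : Type} {g : E → V × V}

theorem Joins.symm {e : E} {a b : V} (h : Joins g e a b) : Joins g e b a := h.elim Or.inr Or.inl

theorem joins_self (e : E) : Joins g e (g e).1 (g e).2 := Or.inl rfl

theorem Joins.unique {e : E} {a b c d : V} (h : Joins g e a b) (h' : Joins g e c d) :
    (a = c ∧ b = d) ∨ (a = d ∧ b = c) := by
  rcases h with h | h <;> rcases h' with h' | h' <;> rw [h] at h' <;>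
    simp only [Prod.mk.injEq] at h' <;> tauto

theorem Joins.mapEnds {π : V → W} {e : E} {a b : V} (h : Joins g e a b) :
    Joins (mapEnds π g) e (π a) (π b) := by
  rcases h with h | h <;> simp [SteinerPacking.mapEnds, Joins, h]

theorem collapse_preimage_singleton {B : Set V} {b : V} (hb : b ∈ B) :
    collapse B b ⁻¹' {b} = B := by
  ext z
  by_cases hz : z ∈ B
  · simp [collapse, hz]
  · have : z ≠ b := fun h => hz (h ▸ hb)
    simp [collapse, hz, this]

theorem collapse_preimage_singleton_of_notMem {B : Set V} {b x : V} (hb : b ∈ B) (hx : x ∉ B) :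
    collapse B b ⁻¹' {x} = {x} := by
  ext z
  have hbx : b ≠ x := fun h => hx (h ▸ hb)
  by_cases hz : z ∈ B
  · have : z ≠ x := fun h => hx (h ▸ hz)
    simp [collapse, hz, hbx, this]
  · simp [collapse, hz]

theorem collapse_of_mem {B : Set V} {b z : V} (hz : z ∈ B) : collapse B b z = b := by
  simp [collapse, hz]

theorem collapse_of_notMem {B : Set V} {b z : V} (hz : z ∉ B) : collapse B b z = z := by
  simp [collapse, hz]

variable [Fintype E]

theorem mem_boundary {X : Set V} {e : E} :
    e ∈ boundary g X ↔ ¬ ((g e).1 ∈ X ↔ (g e).2 ∈ X) := by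
  simp [boundary]

theorem Joins.mem_boundary_iff {X : Set V} {e : E} {a b : V} (h : Joins g e a b) :
    e ∈ boundary g X ↔ ¬ (a ∈ X ↔ b ∈ X) := by
  rw [mem_boundary]
  rcases h with h | h <;> simp only [h]
  tauto

theorem exists_joins_of_mem_boundary {X : Set V} {e : E} (h : e ∈ boundary g X) :
    ∃ a b, Joins g e a b ∧ a ∈ X ∧ b ∉ X := by
  rw [mem_boundary] at h
  by_cases h1 : (g e).1 ∈ X
  · exact ⟨_, _, joins_self e, h1, fun h2 => h ⟨fun _ => h2, fun _ => h1⟩⟩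
  · refine ⟨_, _, (joins_self e).symm, ?_, h1⟩
    by_contra h2
    exact h ⟨fun h => absurd h h1, fun h => absurd h h2⟩

theorem Joins.mem_boundary_of_mem {X : Set V} {e : E} {a b : V} (h : Joins g e a b) (ha : a ∈ X)
    (hb : b ∉ X) : e ∈ boundary g X := by
  rw [h.mem_boundary_iff]; tauto

theorem mem_boundary_singleton {e : E} {x : V} :
    e ∈ boundary g {x} ↔ ∃ y, y ≠ x ∧ Joins g e x y := by
  constructor
  · intro h
    obtain ⟨a, b, hab, ha, hb⟩ := exists_joins_of_mem_boundary h
    rw [Set.mem_singleton_iff] at ha hb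
    exact ⟨b, hb, ha ▸ hab⟩
  · rintro ⟨y, hy, h⟩
    exact h.mem_boundary_of_mem rfl hy

theorem boundary_compl (X : Set V) : boundary g Xᶜ = boundary g X := by
  ext e; simp only [mem_boundary, Set.mem_compl_iff]; tauto

theorem boundary_mapEnds (π : V → W) (X : Set W) :
    boundary (mapEnds π g) X = boundary g (π ⁻¹' X) := rfl

theorem card_boundary_inter_add_union (X Y : Set V) :
    #(boundary g (X ∩ Y)) + #(boundary g (X ∪ Y)) ≤ #(boundary g X) + #(boundary g Y) := by
  simp only [boundary, card_filter, ← sum_add_distrib]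
  refine sum_le_sum fun e _ => ?_
  by_cases h1 : (g e).1 ∈ X <;> by_cases h2 : (g e).1 ∈ Y <;> by_cases h3 : (g e).2 ∈ X <;>
    by_cases h4 : (g e).2 ∈ Y <;> simp [h1, h2, h3, h4]

theorem card_boundary_diff_add_diff (X Y : Set V) :
    #(boundary g (X \ Y)) + #(boundary g (Y \ X)) +
      2 * #(boundary g (X ∩ Y) ∩ boundary g (X ∪ Y)) ≤ #(boundary g X) + #(boundary g Y) := by
  simp only [boundary, ← filter_and, card_filter, mul_sum, ← sum_add_distrib]
  refine sum_le_sum fun e _ => ?_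
  by_cases h1 : (g e).1 ∈ X <;> by_cases h2 : (g e).1 ∈ Y <;> by_cases h3 : (g e).2 ∈ X <;>
    by_cases h4 : (g e).2 ∈ Y <;> simp [h1, h2, h3, h4]

theorem card_boundary_union_singleton {X : Set V} {x : V} (hx : x ∉ X) :
    #(boundary g (X ∪ {x})) + 2 * #(boundary g X ∩ boundary g {x}) =
      #(boundary g X) + #(boundary g {x}) := by
  simp only [boundary, ← filter_and, card_filter, mul_sum, ← sum_add_distrib]
  refine sum_congr rfl fun e _ => ?_
  by_cases h1 : (g e).1 ∈ X <;> by_cases h2 : (g e).1 = x <;> by_cases h3 : (g e).2 ∈ X <;>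
    by_cases h4 : (g e).2 = x <;> simp [h1, h2, h3, h4] <;> (try simp_all)

end

section
open Classical Finset

variable {V E : Type} {k : ℕ} {g : E → V × V} {B : Set V}

/-- Use `col₂` for the edges inside `B` and `col₁` for all other edges. -/
noncomputable def combine (g : E → V × V) (B : Set V) (col₁ col₂ : E → Option (Fin k)) (e : E) :
    Option (Fin k) :=
  if (g e).1 ∈ B ∧ (g e).2 ∈ B then col₂ e else col₁ e

theorem combine_of_mem {col₁ col₂ : E → Option (Fin k)} {e : E} {a b : V} (h : Joins g e a b)
    (ha : a ∈ B) (hb : b ∈ B) : combine g B col₁ col₂ e = col₂ e := by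
  rcases h with h | h <;> simp [combine, h, ha, hb]

theorem combine_of_notMem {col₁ col₂ : E → Option (Fin k)} {e : E} {a b : V} (h : Joins g e a b)
    (ha : a ∉ B) : combine g B col₁ col₂ e = col₁ e := by
  rcases h with h | h <;> simp [combine, h, ha]

variable [Fintype E]

theorem Linked.mono {F F' : E → Prop} {T T' : Set V} (h : Linked g F T)
    (hF : ∀ e, F e → F' e) (hT : T' ⊆ T) : Linked g F' T' := by
  rintro X ⟨s, hs, hsX⟩ ⟨t, ht, htX⟩
  obtain ⟨e, he, hFe⟩ := h X ⟨s, hT hs, hsX⟩ ⟨t, hT ht, htX⟩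
  exact ⟨e, he, hF e hFe⟩

theorem exists_joins_of_mem_boundary_mapEnds {W : Type} {π : V → W} {X : Set W} {e : E}
    (h : e ∈ boundary (mapEnds π g) X) : ∃ a b, Joins g e a b ∧ π a ∈ X ∧ π b ∉ X := by
  rw [boundary_mapEnds] at h
  exact exists_joins_of_mem_boundary h

/-- A connected system in the contraction of the complement of `B` is connected inside `B`. -/
theorem Linked.combine_inner {a₀ : V} {col₁ col₂ : E → Option (Fin k)} {i : Fin k} {T : Set V}
    (h : Linked (mapEnds (collapse Bᶜ a₀) g) (fun e => col₂ e = some i ∧ e ∉ boundary g B) T)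
    {X : Set V} (h1 : ∃ s ∈ T, s ∈ X) (h2 : ∃ s ∈ T, s ∉ X) :
    ∃ e a b, Joins g e a b ∧ a ∈ X ∧ b ∉ X ∧ a ∈ B ∧ b ∈ B ∧
      combine g B col₁ col₂ e = some i := by
  obtain ⟨e, he, hcol, heB⟩ := h X h1 h2
  obtain ⟨a, b, hab, ha, hb⟩ := exists_joins_of_mem_boundary_mapEnds he
  rw [hab.mem_boundary_iff] at heB
  by_cases haB : a ∈ B
  · have hbB : b ∈ B := by tauto
    rw [collapse_of_notMem (by simpa using haB)] at ha
    rw [collapse_of_notMem (by simpa using hbB)] at hb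
    exact ⟨e, a, b, hab, ha, hb, haB, hbB, (combine_of_mem hab haB hbB).trans hcol⟩
  · have hbB : b ∉ B := by tauto
    rw [collapse_of_mem (by simpa using haB)] at ha
    rw [collapse_of_mem (by simpa using hbB)] at hb
    exact absurd ha hb

/-- Connected systems in the two contractions of a cut give a connected system, provided that the
edges of the cut are attached to the inner system. -/
theorem Linked.combine_outer {a₀ b : V} {col₁ col₂ : E → Option (Fin k)} {i : Fin k}
    {P : E → Prop} {T₁ T₂ T : Set V} (hbT : b ∈ T₂)
    (h₁ : Linked (mapEnds (collapse B b) g) (fun e => col₁ e = some i ∧ P e) T₁)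
    (h₂ : Linked (mapEnds (collapse Bᶜ a₀) g) (fun e => col₂ e = some i ∧ e ∉ boundary g B) T₂)
    (hT₂ : ∀ e x y, Joins g e x y → x ∈ B → y ∉ B → col₁ e = some i → x ∈ T₂)
    (hP : ∀ e x y, Joins g e x y → x ∈ B → y ∈ B → P e)
    (hT : ∀ x ∈ T, (x ∉ B ∧ x ∈ T₁) ∨ (x ∈ T₂ ∧ b ∈ T₁)) :
    Linked g (fun e => combine g B col₁ col₂ e = some i ∧ P e) T := by
  rintro X ⟨x, hx, hxX⟩ ⟨y, hy, hyX⟩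
  by_cases hsplit : (∃ s ∈ T₂, s ∈ X) ∧ ∃ s ∈ T₂, s ∉ X
  · obtain ⟨e, c, d, hcd, hc, hd, hcB, hdB, hcol⟩ :=
      h₂.combine_inner (col₁ := col₁) hsplit.1 hsplit.2
    exact ⟨e, hcd.mem_boundary_of_mem hc hd, hcol, hP e c d hcd hcB hdB⟩
  have hside : ∀ z ∈ T₂, (z ∈ X ↔ b ∈ X) := by
    intro z hz
    by_contra hne
    refine hsplit ?_
    by_cases hzX : z ∈ X
    · exact ⟨⟨z, hz, hzX⟩, b, hbT, fun hbX => hne ⟨fun _ => hbX, fun _ => hzX⟩⟩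
    · refine ⟨⟨b, hbT, ?_⟩, z, hz, hzX⟩
      by_contra hbX
      exact hne ⟨fun h => absurd h hzX, fun h => absurd h hbX⟩
  have h1 : ∃ s ∈ T₁, s ∈ X := by
    rcases hT x hx with h | h
    · exact ⟨x, h.2, hxX⟩
    · exact ⟨b, h.2, (hside x h.1).1 hxX⟩
  have h2 : ∃ s ∈ T₁, s ∉ X := by
    rcases hT y hy with h | h
    · exact ⟨y, h.2, hyX⟩
    · exact ⟨b, h.2, fun hbX => hyX ((hside y h.1).2 hbX)⟩
  obtain ⟨e, he, hcol, hPe⟩ := h₁ X h1 h2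
  obtain ⟨c, d, hcd, hc, hd⟩ := exists_joins_of_mem_boundary_mapEnds he
  have hin : ∀ z w, Joins g e z w → w ∉ B → (collapse B b z ∈ X ↔ z ∈ X) := by
    intro z w hzw hw
    by_cases hz : z ∈ B
    · rw [collapse_of_mem hz]
      exact (hside z (hT₂ e z w hzw hz hw hcol)).symm
    · rw [collapse_of_notMem hz]
  by_cases hcB : c ∈ B
  · have hdB : d ∉ B := by
      intro hdB
      rw [collapse_of_mem hcB] at hc
      rw [collapse_of_mem hdB] at hd
      exact hd hc
    rw [hin c d hcd hdB] at hc
    rw [collapse_of_notMem hdB] at hd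
    exact ⟨e, hcd.mem_boundary_of_mem hc hd, (combine_of_notMem hcd.symm hdB).trans hcol, hPe⟩
  · rw [hin d c hcd.symm hcB] at hd
    rw [collapse_of_notMem hcB] at hc
    exact ⟨e, hcd.mem_boundary_of_mem hc hd, (combine_of_notMem hcd hcB).trans hcol, hPe⟩

/-- Contracting a side of a cut to one of its vertices in `S` preserves the edge-connectivity. -/
theorem CutBound.mapEnds_collapse {S : Set V} {Q : ℕ} (h : CutBound g S Q) {b : V}
    (hb : b ∈ B) (hbS : b ∈ S) : CutBound (mapEnds (collapse B b) g) ((S \ B) ∪ {b}) Q := by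
  have hfix : ∀ s ∈ (S \ B) ∪ {b}, collapse B b s = s ∧ s ∈ S := by
    rintro s (hs | hs)
    · exact ⟨collapse_of_notMem hs.2, hs.1⟩
    · rw [Set.mem_singleton_iff] at hs
      subst hs
      exact ⟨collapse_of_mem hb, hbS⟩
  rintro X ⟨s, hs, hsX⟩ ⟨t, ht, htX⟩
  rw [boundary_mapEnds]
  refine h _ ⟨s, (hfix s hs).2, ?_⟩ ⟨t, (hfix t ht).2, ?_⟩
  · simpa [(hfix s hs).1] using hsX
  · simpa [(hfix t ht).1] using htX

theorem mem_properEdges {e : E} : e ∈ properEdges g ↔ (g e).1 ≠ (g e).2 := by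
  simp [properEdges]

theorem Joins.mem_properEdges_iff {e : E} {a b : V} (h : Joins g e a b) :
    e ∈ properEdges g ↔ a ≠ b := by
  rw [mem_properEdges]
  rcases h with h | h <;> simp only [h]
  exact ne_comm

theorem card_properEdges_mapEnds_lt {b : V} {e : E} {x y : V} (h : Joins g e x y)
    (hx : x ∈ B) (hy : y ∈ B) (hxy : x ≠ y) :
    #(properEdges (mapEnds (collapse B b) g)) < #(properEdges g) := by
  refine card_lt_card ((ssubset_iff_of_subset fun f hf => ?_).2
    ⟨e, h.mem_properEdges_iff.2 hxy, fun he => ?_⟩)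
  · rw [mem_properEdges] at hf ⊢
    exact fun h => hf (congrArg (collapse B b) h)
  · rw [h.mapEnds.mem_properEdges_iff, collapse_of_mem hx, collapse_of_mem hy] at he
    exact he rfl

end

section
open Classical Finset

/-- The hypotheses of the extension theorem for a vertex `v` whose incident edges are coloured by
`pc`. -/
structure IsRooted {V E : Type} [Fintype E] {k : ℕ} (Q : ℕ) (g : E → V × V) (S : Set V) (v : V)
    (pc : E → Fin k) : Prop where
  cut : CutBound g S Q
  mem : v ∈ S
  exists_ne : ∃ s ∈ S, s ≠ v
  card : #(boundary g {v}) = Q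
  two_le : ∀ i, 2 ≤ #{e ∈ boundary g {v} | pc e = i}

/-- There is a packing that extends `pc` at `v` and is balanced at the other vertices of `S`. -/
def HasBalancedPacking {V E : Type} [Fintype E] {k : ℕ} (g : E → V × V) (S : Set V) (v : V)
    (pc : E → Fin k) : Prop :=
  ∃ col : E → Option (Fin k), Extends g S v (fun e => some (pc e)) col ∧
    ∀ s ∈ S, s ≠ v → Balanced g col s

variable {V E : Type} [Fintype E] {k Q : ℕ} {g : E → V × V} {S : Set V} {v : V} {pc : E → Fin k}

/-- Rooted packings on the two sides of a tight cut can be glued together. -/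
theorem IsRooted.hasBalancedPacking_of_tight (h : IsRooted Q g S v pc) {B : Set V} (hvB : v ∉ B)
    {b : V} (hb : b ∈ B) (hbS : b ∈ S) (htight : #(boundary g B) = Q)
    (hin : ∃ e x y, Joins g e x y ∧ x ∈ B ∧ y ∈ B ∧ x ≠ y)
    (hout : ∃ e x y, Joins g e x y ∧ x ∉ B ∧ y ∉ B ∧ x ≠ y)
    (ih : ∀ (g' : E → V × V) (S' : Set V) (v' : V) (pc' : E → Fin k),
      #(properEdges g') < #(properEdges g) → IsRooted Q g' S' v' pc' →
        HasBalancedPacking g' S' v' pc') :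
    HasBalancedPacking g S v pc := by
  have hbv : b ≠ v := fun h => hvB (h ▸ hb)
  obtain ⟨e₁, x₁, y₁, hj₁, hx₁, hy₁, hne₁⟩ := hin
  obtain ⟨e₂, x₂, y₂, hj₂, hx₂, hy₂, hne₂⟩ := hout
  have hvB' : v ∈ Bᶜ := hvB
  have hb₁ : boundary (mapEnds (collapse B b) g) {v} = boundary g {v} := by
    rw [boundary_mapEnds, collapse_preimage_singleton_of_notMem hb hvB]
  have hb₁' : boundary (mapEnds (collapse B b) g) {b} = boundary g B := by
    rw [boundary_mapEnds, collapse_preimage_singleton hb]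
  have hb₂ : boundary (mapEnds (collapse Bᶜ v) g) {v} = boundary g B := by
    rw [boundary_mapEnds, collapse_preimage_singleton hvB', boundary_compl]
  obtain ⟨col₁, hext₁, hbal₁⟩ := ih (mapEnds (collapse B b) g) ((S \ B) ∪ {b}) v pc
    (card_properEdges_mapEnds_lt hj₁ hx₁ hy₁ hne₁)
    { cut := h.cut.mapEnds_collapse hb hbS
      mem := Or.inl ⟨h.mem, hvB⟩
      exists_ne := ⟨b, Or.inr rfl, hbv⟩
      card := by rw [hb₁]; exact h.card
      two_le := by rw [hb₁]; exact h.two_le }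
  obtain ⟨q, hq, hq2⟩ := hbal₁ b (Or.inr rfl) hbv
  rw [hb₁'] at hq hq2
  obtain ⟨col₂, hext₂, hbal₂⟩ := ih (mapEnds (collapse Bᶜ v) g) ((S \ Bᶜ) ∪ {v}) v q
    (card_properEdges_mapEnds_lt hj₂ hx₂ hy₂ hne₂)
    { cut := h.cut.mapEnds_collapse hvB' h.mem
      mem := Or.inr rfl
      exists_ne := ⟨b, Or.inl ⟨hbS, by simpa using hb⟩, hbv⟩
      card := by rw [hb₂]; exact htight
      two_le := by rw [hb₂]; exact hq2 }
  have hcol₁ : ∀ e ∈ boundary g {v}, combine g B col₁ col₂ e = col₁ e := by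
    intro e he
    obtain ⟨y, -, hj⟩ := mem_boundary_singleton.1 he
    exact combine_of_notMem hj hvB
  have hagree₁ := hext₁.agree
  have hagree₂ := hext₂.agree
  rw [hb₁] at hagree₁
  rw [hb₂] at hagree₂
  have hlink₁ := hext₁.linked
  have hlink₂ := hext₂.linked
  rw [hb₁] at hlink₁
  rw [hb₂] at hlink₂
  refine ⟨combine g B col₁ col₂, ⟨fun e he => (hcol₁ e he).trans (hagree₁ e he), fun i => ?_⟩, ?_⟩
  · set T₂ : Set V := {x | x ∈ B ∧ (x ∈ S ∨ ∃ e y, Joins g e x y ∧ y ∉ B ∧ q e = i)} with hT₂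
    have hT₂' : T₂ ⊆ terminals (mapEnds (collapse Bᶜ v) g) ((S \ Bᶜ) ∪ {v}) v
        (fun e => some (q e)) i := by
      rintro x ⟨hxB, hx⟩
      refine ⟨fun h => hvB (h ▸ hxB), ?_⟩
      rcases hx with hx | ⟨e, y, hj, hy, hqe⟩
      · exact Or.inl (Or.inl ⟨hx, by simpa using hxB⟩)
      · refine Or.inr ⟨e, ?_, by simp [hqe]⟩
        have := (hj.mapEnds (π := collapse Bᶜ v)).symm
        rwa [collapse_of_mem (show y ∈ Bᶜ from hy), collapse_of_notMem (by simpa using hxB)] at this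
    have hmem : ∀ e x y, Joins g e x y → x ∈ B → y ∉ B → col₁ e = some i → x ∈ T₂ := by
      intro e x y hj hx hy hcol
      exact ⟨hx, Or.inr ⟨e, y, hj, hy, hq e (hj.mem_boundary_of_mem hx hy) i hcol⟩⟩
    refine Linked.combine_outer (b := b) (T₂ := T₂) ⟨hb, Or.inl hbS⟩ (hlink₁ i)
      ((hlink₂ i).mono (fun _ h => h) hT₂') hmem ?_ ?_
    · intro e x y hj hx hy he
      rw [hj.mem_boundary_iff] at he
      have hxv : x ≠ v := fun h => hvB (h ▸ hx)
      have hyv : y ≠ v := fun h => hvB (h ▸ hy)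
      simp [hxv, hyv] at he
    · rintro x ⟨hxv, hx⟩
      by_cases hxB : x ∈ B
      · right
        refine ⟨?_, hbv, Or.inl (Or.inr rfl)⟩
        rcases hx with hx | ⟨e, hj, hpc⟩
        · exact ⟨hxB, Or.inl hx⟩
        · refine hmem e x v hj.symm hxB hvB ?_
          rw [hagree₁ e (mem_boundary_singleton.2 ⟨x, hxv, hj⟩)]
          exact hpc
      · left
        refine ⟨hxB, hxv, ?_⟩
        rcases hx with hx | ⟨e, hj, hpc⟩
        · exact Or.inl (Or.inl ⟨hx, hxB⟩)
        · refine Or.inr ⟨e, ?_, hpc⟩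
          have := hj.mapEnds (π := collapse B b)
          rwa [collapse_of_notMem hvB, collapse_of_notMem hxB] at this
  · intro s hs hsv
    by_cases hsB : s ∈ B
    · obtain ⟨q₂, hq₂, hq₂2⟩ := hbal₂ s (Or.inl ⟨hs, by simpa using hsB⟩) hsv
      rw [boundary_mapEnds, collapse_preimage_singleton_of_notMem hvB' (by simpa using hsB)]
        at hq₂ hq₂2
      refine ⟨q₂, fun e he i hcol => ?_, hq₂2⟩
      obtain ⟨y, hys, hj⟩ := mem_boundary_singleton.1 he
      by_cases hy : y ∈ B
      · rw [combine_of_mem hj hsB hy] at hcol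
        exact hq₂ e he i hcol
      · rw [combine_of_notMem hj.symm hy] at hcol
        have heB := hj.mem_boundary_of_mem hsB hy
        refine hq₂ e he i ?_
        rw [hagree₂ e heB, hq e heB i hcol]
    · obtain ⟨q₁, hq₁, hq₁2⟩ := hbal₁ s (Or.inl ⟨hs, hsB⟩) hsv
      rw [boundary_mapEnds, collapse_preimage_singleton_of_notMem hb hsB] at hq₁ hq₁2
      refine ⟨q₁, fun e he i hcol => hq₁ e he i ?_, hq₁2⟩
      obtain ⟨y, hys, hj⟩ := mem_boundary_singleton.1 he
      rwa [combine_of_notMem hj hsB] at hcol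

end

section
open Classical Finset

variable {V E : Type} {k Q : ℕ} {g : E → V × V} {S : Set V} {v : V} {pc : E → Fin k}

theorem joins_update_of_ne {e f : E} {p : V × V} (h : e ≠ f) {a b : V} :
    Joins (Function.update g f p) e a b ↔ Joins g e a b := by
  simp [Joins, h]

variable [Fintype E]

theorem mem_boundary_update_of_ne {e f : E} {p : V × V} (h : e ≠ f) {X : Set V} :
    e ∈ boundary (Function.update g f p) X ↔ e ∈ boundary g X := by
  simp [mem_boundary, h]

theorem notMem_boundary_update_self {f : E} {x : V} {X : Set V} :
    f ∉ boundary (Function.update g f (x, x)) X := by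
  simp [mem_boundary]

theorem boundary_update_loop (f : E) (x : V) (X : Set V) :
    boundary (Function.update g f (x, x)) X = (boundary g X).erase f := by
  ext e
  by_cases h : e = f
  · subst h
    simp [notMem_boundary_update_self]
  · simp [mem_boundary_update_of_ne h, h]

theorem IsRooted.separates (h : IsRooted Q g S v pc) :
    (∃ s ∈ S, s ∈ ({v} : Set V)) ∧ ∃ s ∈ S, s ∉ ({v} : Set V) := by
  obtain ⟨s, hs, hsv⟩ := h.exists_ne
  exact ⟨⟨v, h.mem, rfl⟩, s, hs, hsv⟩

/-- An edge contained only in large cuts can be deleted. -/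
theorem IsRooted.hasBalancedPacking_of_delete (h : IsRooted Q g S v pc) {f : E}
    (hf : f ∈ properEdges g)
    (hcut : ∀ X : Set V, (∃ s ∈ S, s ∈ X) → (∃ s ∈ S, s ∉ X) → f ∈ boundary g X →
      Q + 1 ≤ #(boundary g X))
    (ih : ∀ (g' : E → V × V) (S' : Set V) (v' : V) (pc' : E → Fin k),
      #(properEdges g') < #(properEdges g) → IsRooted Q g' S' v' pc' →
        HasBalancedPacking g' S' v' pc') :
    HasBalancedPacking g S v pc := by
  have hfv : f ∉ boundary g {v} := by
    intro hfv
    have := hcut {v} h.separates.1 h.separates.2 hfv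
    have := h.card
    omega
  set g' := Function.update g f (v, v) with hg'
  have hb : boundary g' {v} = boundary g {v} := by
    rw [hg', boundary_update_loop, erase_eq_of_notMem hfv]
  have hlt : #(properEdges g') < #(properEdges g) := by
    refine card_lt_card ((ssubset_iff_of_subset fun e he => ?_).2 ⟨f, hf, fun he => ?_⟩)
    · rw [mem_properEdges] at he ⊢
      by_cases hef : e = f
      · subst hef; simp [hg'] at he
      · simpa [hg', hef] using he
    · rw [mem_properEdges] at he
      simp [hg'] at he
  obtain ⟨col, hext, hbal⟩ := ih g' S v pc hlt
    { cut := by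
        intro X h1 h2
        rw [hg', boundary_update_loop]
        by_cases hfX : f ∈ boundary g X
        · have := hcut X h1 h2 hfX
          rw [card_erase_of_mem hfX]
          omega
        · rw [erase_eq_of_notMem hfX]
          exact h.cut X h1 h2
      mem := h.mem
      exists_ne := h.exists_ne
      card := by rw [hb]; exact h.card
      two_le := by rw [hb]; exact h.two_le }
  · have hagree := hext.agree
    have hlink := hext.linked
    rw [hb] at hagree hlink
    refine ⟨fun e => if e = f then none else col e, ⟨fun e he => ?_, fun i => ?_⟩, ?_⟩
    · have : e ≠ f := fun h => hfv (h ▸ he)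
      simp only [this, if_false]
      exact hagree e he
    · intro X h1 h2
      have hsub : terminals g S v (fun e => some (pc e)) i ⊆
          terminals g' S v (fun e => some (pc e)) i := by
        rintro x ⟨hxv, hx⟩
        refine ⟨hxv, hx.imp_right ?_⟩
        rintro ⟨e, hj, hpc⟩
        have hef : e ≠ f := fun h => hfv (h ▸ mem_boundary_singleton.2 ⟨x, hxv, hj⟩)
        exact ⟨e, (joins_update_of_ne hef).2 hj, hpc⟩
      obtain ⟨e, he, hcol, hev⟩ := ((hlink i).mono (fun _ h => h) hsub) X h1 h2
      rw [hg', boundary_update_loop] at he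
      have hef := (mem_erase.1 he).1
      exact ⟨e, (mem_erase.1 he).2, by simp [hef, hcol], hev⟩
    · intro s hs hsv
      obtain ⟨q, hq, hq2⟩ := hbal s hs hsv
      rw [hg', boundary_update_loop] at hq hq2
      refine ⟨q, fun e he i hcol => ?_, fun i => (hq2 i).trans (card_le_card ?_)⟩
      · by_cases hef : e = f
        · simp [hef] at hcol
        · simp only [hef, if_false] at hcol
          exact hq e (mem_erase.2 ⟨hef, he⟩) i hcol
      · exact filter_subset_filter _ (erase_subset _ _)

/-- A pair of edges at a vertex outside `S` that is contained only in large cuts can be split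
off. -/
theorem IsRooted.hasBalancedPacking_of_split (h : IsRooted Q g S v pc) {e f : E} {x y z : V}
    (he : Joins g e x y) (hf : Joins g f x z) (hx : x ∉ S) (hy : y ∈ S) (hz : z ∈ S)
    (hyz : y ≠ z) (hzv : z ≠ v)
    (hcut : ∀ X : Set V, (∃ s ∈ S, s ∈ X) → (∃ s ∈ S, s ∉ X) → x ∉ X → y ∈ X → z ∈ X →
      Q + 2 ≤ #(boundary g X))
    (ih : ∀ (g' : E → V × V) (S' : Set V) (v' : V) (pc' : E → Fin k),
      #(properEdges g') < #(properEdges g) → IsRooted Q g' S' v' pc' →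
        HasBalancedPacking g' S' v' pc') :
    HasBalancedPacking g S v pc := by
  have hxy : x ≠ y := fun h => hx (h ▸ hy)
  have hxz : x ≠ z := fun h => hx (h ▸ hz)
  have hxv : x ≠ v := fun h' => hx (h' ▸ h.mem)
  have hef : e ≠ f := by
    rintro rfl
    rcases he.unique hf with h | h
    · exact hyz h.2
    · exact hxz h.1
  set g' := Function.update (Function.update g e (y, z)) f (x, x) with hg'
  have hje : Joins g' e y z := by
    rw [hg', joins_update_of_ne hef]
    left
    simp
  have hjw : ∀ w, w ≠ e → w ≠ f → ∀ a b, Joins g' w a b ↔ Joins g w a b := by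
    intro w hwe hwf a b
    rw [hg', joins_update_of_ne hwf, joins_update_of_ne hwe]
  have hbw : ∀ w, w ≠ e → w ≠ f → ∀ X, w ∈ boundary g' X ↔ w ∈ boundary g X := by
    intro w hwe hwf X
    rw [hg', mem_boundary_update_of_ne hwf, mem_boundary_update_of_ne hwe]
  have hbf : ∀ X, f ∉ boundary g' X := fun X => notMem_boundary_update_self
  have hbe : ∀ X, e ∈ boundary g' X ↔ ¬ (y ∈ X ↔ z ∈ X) := fun X => hje.mem_boundary_iff
  have hbe' : ∀ X, e ∈ boundary g X ↔ ¬ (x ∈ X ↔ y ∈ X) := fun X => he.mem_boundary_iff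
  have hbf' : ∀ X, f ∈ boundary g X ↔ ¬ (x ∈ X ↔ z ∈ X) := fun X => hf.mem_boundary_iff
  have hsame : ∀ X, (x ∈ X ↔ z ∈ X) → boundary g' X = boundary g X := by
    intro X hX
    ext w
    by_cases hwe : w = e
    · subst hwe; rw [hbe, hbe']; tauto
    by_cases hwf : w = f
    · subst hwf; simp [hbf, hbf', hX]
    exact hbw w hwe hwf X
  have hswap : ∀ X w, w ∈ boundary g X → (x ∈ X ↔ y ∈ X) →
      Equiv.swap e f w ∈ boundary g' X := by
    intro X w hw hX
    by_cases hwe : w = e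
    · subst hwe; rw [hbe'] at hw; exact absurd hX hw
    by_cases hwf : w = f
    · subst hwf; rw [hbf'] at hw; rw [Equiv.swap_apply_right, hbe]; tauto
    rw [Equiv.swap_apply_of_ne_of_ne hwe hwf, hbw w hwe hwf]
    exact hw
  have hb : boundary g' {v} = boundary g {v} := hsame {v} (by simp [hxv, hzv])
  have hcut' : ∀ X : Set V, (∃ s ∈ S, s ∈ X) → (∃ s ∈ S, s ∉ X) → x ∉ X →
      Q ≤ #(boundary g' X) := by
    intro X h1 h2 hxX
    by_cases hzX : z ∈ X
    · by_cases hyX : y ∈ X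
      · have := hcut X h1 h2 hxX hyX hzX
        have h3 : boundary g X ⊆ insert e (insert f (boundary g' X)) := by
          intro w hw
          by_cases hwe : w = e
          · simp [hwe]
          by_cases hwf : w = f
          · simp [hwf]
          simp [hwe, hwf, hbw w hwe hwf X, hw]
        have h4 := card_le_card h3
        have h5 := card_insert_le e (insert f (boundary g' X))
        have h6 := card_insert_le f (boundary g' X)
        omega
      · refine (h.cut X h1 h2).trans (card_le_card_of_injOn (Equiv.swap e f) ?_
          (Equiv.injective _).injOn)
        intro w hw
        exact hswap X w hw (by tauto)
    · rw [hsame X (by tauto)]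
      exact h.cut X h1 h2
  have hlt : #(properEdges g') < #(properEdges g) := by
    refine card_lt_card ((ssubset_iff_of_subset fun w hw => ?_).2
      ⟨f, hf.mem_properEdges_iff.2 hxz, fun hc => ?_⟩)
    · by_cases hwe : w = e
      · subst hwe; exact he.mem_properEdges_iff.2 hxy
      by_cases hwf : w = f
      · subst hwf; exact hf.mem_properEdges_iff.2 hxz
      rw [mem_properEdges] at hw ⊢
      simpa [hg', hwe, hwf] using hw
    · rw [mem_properEdges] at hc
      simp [hg'] at hc
  obtain ⟨col, hext, hbal⟩ := ih g' S v pc hlt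
    { cut := by
        intro X h1 h2
        by_cases hxX : x ∈ X
        · rw [← boundary_compl]
          obtain ⟨s, hs, hsX⟩ := h1
          exact hcut' Xᶜ h2 ⟨s, hs, fun hc => hc hsX⟩ (fun hc => hc hxX)
        · exact hcut' X h1 h2 hxX
      mem := h.mem
      exists_ne := h.exists_ne
      card := by rw [hb]; exact h.card
      two_le := by rw [hb]; exact h.two_le }
  · have hagree := hext.agree
    have hlink := hext.linked
    rw [hb] at hagree hlink
    have hfv : f ∉ boundary g {v} := by
      rw [hbf']; simp [hxv, hzv]
    refine ⟨fun w => if w = f then col e else col w, ⟨fun w hw => ?_, fun i => ?_⟩, ?_⟩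
    · have : w ≠ f := fun h => hfv (h ▸ hw)
      simp only [this, if_false]
      exact hagree w hw
    · have hterm : ∀ t ∈ terminals g S v (fun e => some (pc e)) i,
          t ∈ terminals g' S v (fun e => some (pc e)) i ∨ (t = x ∧ y = v ∧ pc e = i) := by
        rintro t ⟨htv, ht⟩
        rcases ht with ht | ⟨w, hj, hpc⟩
        · exact Or.inl ⟨htv, Or.inl ht⟩
        · have hwf : w ≠ f := fun h => hfv (h ▸ mem_boundary_singleton.2 ⟨t, htv, hj⟩)
          by_cases hwe : w = e
          · subst hwe
            rcases hj.unique he with h | h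
            · exact absurd h.1.symm hxv
            · exact Or.inr ⟨h.2, h.1.symm, by simpa using hpc⟩
          · exact Or.inl ⟨htv, Or.inr ⟨w, (hjw w hwe hwf _ _).2 hj, hpc⟩⟩
      have hzt : z ∈ terminals g' S v (fun e => some (pc e)) i := ⟨hzv, Or.inl hz⟩
      intro X h1 h2
      by_cases hxz' : (∃ t ∈ terminals g S v (fun e => some (pc e)) i, t = x ∧ y = v ∧ pc e = i) ∧
          ¬ (x ∈ X ↔ z ∈ X)
      · obtain ⟨⟨-, -, -, hyv, hpc⟩, hX⟩ := hxz'
        refine ⟨f, (hbf' X).2 hX, ?_, hfv⟩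
        have : e ∈ boundary g {v} := by rw [hbe']; simp [hyv, hxv]
        simp [hagree e this, hpc]
      have hlift : ∀ t ∈ terminals g S v (fun e => some (pc e)) i,
          ∃ t' ∈ terminals g' S v (fun e => some (pc e)) i, (t' ∈ X ↔ t ∈ X) := by
        intro t ht
        rcases hterm t ht with h' | h'
        · exact ⟨t, h', Iff.rfl⟩
        · refine ⟨z, hzt, ?_⟩
          have : ¬ ¬ (x ∈ X ↔ z ∈ X) := fun hn => hxz' ⟨⟨t, ht, h'⟩, hn⟩
          rw [h'.1]
          tauto
      obtain ⟨w, hw, hcol, hwv⟩ := hlink i X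
        (by obtain ⟨t, ht, htX⟩ := h1
            obtain ⟨t', ht', hiff⟩ := hlift t ht
            exact ⟨t', ht', hiff.2 htX⟩)
        (by obtain ⟨t, ht, htX⟩ := h2
            obtain ⟨t', ht', hiff⟩ := hlift t ht
            exact ⟨t', ht', fun hc => htX (hiff.1 hc)⟩)
      by_cases hwe : w = e
      · subst hwe
        by_cases hwX : w ∈ boundary g X
        · exact ⟨w, hwX, by simp [hef, hcol], hwv⟩
        · refine ⟨f, ?_, by simp [hcol], hfv⟩
          rw [hbe] at hw
          rw [hbe'] at hwX
          rw [hbf']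
          tauto
      have hwf : w ≠ f := fun h => hbf X (h ▸ hw)
      exact ⟨w, (hbw w hwe hwf X).1 hw, by simp [hwf, hcol], hwv⟩
    · intro s hs hsv
      have hxs : x ≠ s := fun h => hx (h ▸ hs)
      obtain ⟨q, hq, hq2⟩ := hbal s hs hsv
      by_cases hsz : z = s
      · subst hsz
        refine ⟨fun w => if w = f then q e else q w, fun w hw i hcol => ?_, fun i => ?_⟩
        · by_cases hwf : w = f
          · simp only [hwf, if_true] at hcol ⊢
            refine hq e ?_ i hcol
            rw [hbe]; simp [hyz]
          · simp only [hwf, if_false] at hcol ⊢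
            refine hq w ?_ i hcol
            have hwe : w ≠ e := by
              rintro rfl
              rw [hbe'] at hw
              simp [hxz, hyz] at hw
            exact (hbw w hwe hwf _).2 hw
        · refine (hq2 i).trans (card_le_card_of_injOn (Equiv.swap e f) ?_
            (Equiv.injective _).injOn)
          intro w hw
          obtain ⟨hw1, hw2⟩ := mem_filter.1 (mem_coe.1 hw)
          have hwf : w ≠ f := fun h => hbf _ (h ▸ hw1)
          refine mem_coe.2 (mem_filter.2 ?_)
          by_cases hwe : w = e
          · subst hwe
            rw [Equiv.swap_apply_left, hbf']
            simp [hxz, hw2]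
          · rw [Equiv.swap_apply_of_ne_of_ne hwe hwf]
            exact ⟨(hbw w hwe hwf _).1 hw1, by simp [hwf, hw2]⟩
      · have hbs : boundary g' {s} = boundary g {s} := hsame {s} (by simp [hxs, hsz])
        rw [hbs] at hq hq2
        refine ⟨q, fun w hw i hcol => hq w hw i ?_, hq2⟩
        have hwf : w ≠ f := by
          rintro rfl
          rw [hbf'] at hw
          simp [hxs, hsz] at hw
        simpa [hwf] using hcol

end

section
open Classical Finset

/-- Every tight cut separating `S` consists of the edges at a vertex of `S`, up to isolated
vertices. -/
def TightCutsTrivial {V E : Type} [Fintype E] (g : E → V × V) (S : Set V) (Q : ℕ) : Prop :=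
  ∀ X : Set V, (∃ s ∈ S, s ∈ X) → (∃ s ∈ S, s ∉ X) → #(boundary g X) = Q →
    ∃ s ∈ S, boundary g X = boundary g {s} ∧
      ((∀ z ∈ X, z ≠ s → boundary g {z} = ∅) ∨ ∀ z ∉ X, z ≠ s → boundary g {z} = ∅)

variable {V E : Type} [Fintype E] {k Q : ℕ} {g : E → V × V} {S : Set V} {v : V} {pc : E → Fin k}

theorem CutBound.boundary_eq_singleton (h : CutBound g S Q) {X : Set V} (h1 : ∃ s ∈ S, s ∈ X)
    (h2 : ∃ s ∈ S, s ∉ X) (ht : #(boundary g X) = Q)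
    (hin : ∀ e x y, Joins g e x y → x ∈ X → y ∈ X → x = y) :
    ∃ s ∈ S, boundary g X = boundary g {s} ∧ ∀ z ∈ X, z ≠ s → boundary g {z} = ∅ := by
  obtain ⟨s, hs, hsX⟩ := h1
  obtain ⟨s', hs', hsX'⟩ := h2
  have hsub : boundary g {s} ⊆ boundary g X := by
    intro e he
    obtain ⟨y, hy, hj⟩ := mem_boundary_singleton.1 he
    exact hj.mem_boundary_of_mem hsX fun hyX => hy (hin e s y hj hsX hyX).symm
  have heq : boundary g {s} = boundary g X :=
    eq_of_subset_of_card_le hsub (ht.trans_le (h {s} ⟨s, hs, rfl⟩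
      ⟨s', hs', fun hc => hsX' (Set.mem_singleton_iff.1 hc ▸ hsX)⟩))
  refine ⟨s, hs, heq.symm, fun z hz hzs => ?_⟩
  refine eq_empty_of_forall_notMem fun e he => ?_
  obtain ⟨y, hy, hj⟩ := mem_boundary_singleton.1 he
  have hyX : y ∉ X := fun hyX => hy (hin e z y hj hz hyX).symm
  have h3 := hj.mem_boundary_of_mem hz hyX
  rw [← heq] at h3
  obtain ⟨w, hw, hj'⟩ := mem_boundary_singleton.1 h3
  rcases hj.unique hj' with h4 | h4
  · exact hzs h4.1
  · exact hyX (h4.2 ▸ hsX)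

theorem IsRooted.tightCutsTrivial_or (h : IsRooted Q g S v pc)
    (ih : ∀ (g' : E → V × V) (S' : Set V) (v' : V) (pc' : E → Fin k),
      #(properEdges g') < #(properEdges g) → IsRooted Q g' S' v' pc' →
        HasBalancedPacking g' S' v' pc') :
    HasBalancedPacking g S v pc ∨ TightCutsTrivial g S Q := by
  by_cases hT : ∃ X : Set V, v ∉ X ∧ (∃ s ∈ S, s ∈ X) ∧ #(boundary g X) = Q ∧
      (∃ e x y, Joins g e x y ∧ x ∈ X ∧ y ∈ X ∧ x ≠ y) ∧
      ∃ e x y, Joins g e x y ∧ x ∉ X ∧ y ∉ X ∧ x ≠ y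
  · obtain ⟨X, hv, ⟨b, hbS, hb⟩, ht, hin, hout⟩ := hT
    exact Or.inl (h.hasBalancedPacking_of_tight hv hb hbS ht hin hout ih)
  · push Not at hT
    have key : ∀ X : Set V, v ∉ X → (∃ s ∈ S, s ∈ X) → #(boundary g X) = Q →
        ∃ s ∈ S, boundary g X = boundary g {s} ∧
          ((∀ z ∈ X, z ≠ s → boundary g {z} = ∅) ∨ ∀ z ∉ X, z ≠ s → boundary g {z} = ∅) := by
      intro X hv h1 ht
      by_cases hin : ∃ e x y, Joins g e x y ∧ x ∈ X ∧ y ∈ X ∧ x ≠ y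
      · have hout := hT X hv h1 ht hin
        obtain ⟨s, hs, hsX⟩ := h1
        obtain ⟨t, ht, hb, hz⟩ := h.cut.boundary_eq_singleton (X := Xᶜ) ⟨v, h.mem, hv⟩
          ⟨s, hs, fun hc => hc hsX⟩ (by rw [boundary_compl]; exact ht)
          (fun e x y hj hx hy => hout e x y hj hx hy)
        exact ⟨t, ht, by rw [← hb, boundary_compl], Or.inr hz⟩
      · push Not at hin
        obtain ⟨t, ht, hb, hz⟩ := h.cut.boundary_eq_singleton h1 ⟨v, h.mem, hv⟩ ht hin
        exact ⟨t, ht, hb, Or.inl hz⟩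
    refine Or.inr fun X h1 h2 ht => ?_
    by_cases hv : v ∈ X
    · obtain ⟨t, hts, hb, hz⟩ := key Xᶜ (fun hc => hc hv) h2 (by rw [boundary_compl]; exact ht)
      refine ⟨t, hts, by rw [← hb, boundary_compl], ?_⟩
      rcases hz with hz | hz
      · exact Or.inr hz
      · exact Or.inl fun z hzX => hz z (fun hc => hc hzX)
    · exact key X hv h1 ht

/-- An edge with no end in `S` can be deleted. -/
theorem IsRooted.hasBalancedPacking_of_outside (h : IsRooted Q g S v pc)
    (hT : TightCutsTrivial g S Q) {f : E} {a b : V} (hf : Joins g f a b) (ha : a ∉ S) (hb : b ∉ S)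
    (hab : a ≠ b)
    (ih : ∀ (g' : E → V × V) (S' : Set V) (v' : V) (pc' : E → Fin k),
      #(properEdges g') < #(properEdges g) → IsRooted Q g' S' v' pc' →
        HasBalancedPacking g' S' v' pc') :
    HasBalancedPacking g S v pc := by
  refine h.hasBalancedPacking_of_delete (hf.mem_properEdges_iff.2 hab) (fun X h1 h2 hfX => ?_) ih
  have hle := h.cut X h1 h2
  rcases hle.lt_or_eq with hlt | heq
  · exact hlt
  obtain ⟨s, hs, hb', -⟩ := hT X h1 h2 heq.symm
  rw [hb'] at hfX
  obtain ⟨y, -, hj⟩ := mem_boundary_singleton.1 hfX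
  rcases hf.unique hj with h4 | h4
  · exact absurd (h4.1 ▸ hs) ha
  · exact absurd (h4.2 ▸ hs) hb

/-- If more than half of the edges at a vertex outside `S` lead to the same neighbour, then one of
them can be deleted. -/
theorem IsRooted.hasBalancedPacking_of_majority (h : IsRooted Q g S v pc) {f : E} {x y : V}
    (hf : Joins g f x y) (hx : x ∉ S) (hxy : x ≠ y)
    (hmaj : #(boundary g {x}) < 2 * #{e | Joins g e x y})
    (ih : ∀ (g' : E → V × V) (S' : Set V) (v' : V) (pc' : E → Fin k),
      #(properEdges g') < #(properEdges g) → IsRooted Q g' S' v' pc' →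
        HasBalancedPacking g' S' v' pc') :
    HasBalancedPacking g S v pc := by
  have key : ∀ X : Set V, (∃ s ∈ S, s ∈ X) → (∃ s ∈ S, s ∉ X) → x ∉ X → y ∈ X →
      Q + 1 ≤ #(boundary g X) := by
    rintro X ⟨s, hs, hsX⟩ ⟨t, ht, htX⟩ hxX hyX
    have h1 := card_boundary_union_singleton (g := g) hxX
    have h2 := h.cut (X ∪ {x}) ⟨s, hs, Or.inl hsX⟩ ⟨t, ht, by
      rintro (h3 | h3)
      · exact htX h3
      · exact hx (Set.mem_singleton_iff.1 h3 ▸ ht)⟩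
    have h3 : #{e | Joins g e x y} ≤ #(boundary g X ∩ boundary g {x}) := by
      refine card_le_card fun e he => ?_
      have hj : Joins g e x y := by simpa using he
      exact mem_inter.2 ⟨hj.symm.mem_boundary_of_mem hyX hxX,
        mem_boundary_singleton.2 ⟨y, hxy.symm, hj⟩⟩
    omega
  refine h.hasBalancedPacking_of_delete (hf.mem_properEdges_iff.2 hxy) (fun X h1 h2 hfX => ?_) ih
  rw [hf.mem_boundary_iff] at hfX
  by_cases hxX : x ∈ X
  · rw [← boundary_compl]
    obtain ⟨s, hs, hsX⟩ := h1
    exact key Xᶜ h2 ⟨s, hs, fun hc => hc hsX⟩ (fun hc => hc hxX) (by tauto)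
  · exact key X h1 h2 hxX (by tauto)

end

section
open Classical Finset

/-- A cut separating `S` but not containing `x` that prevents pairs of edges at `x` from being split
off. -/
structure IsDangerous {V E : Type} [Fintype E] (g : E → V × V) (S : Set V) (Q : ℕ) (x : V)
    (X : Set V) : Prop where
  exists_mem : ∃ s ∈ S, s ∈ X
  exists_notMem : ∃ s ∈ S, s ∉ X
  notMem : x ∉ X
  card_le : #(boundary g X) ≤ Q + 1

variable {V E : Type} [Fintype E] {k Q : ℕ} {g : E → V × V} {S : Set V} {v : V} {pc : E → Fin k}

theorem IsDangerous.uncrossing {x : V} {X Y : Set V} (hX : IsDangerous g S Q x X)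
    (hY : IsDangerous g S Q x Y) (hcut : CutBound g S Q) (hT : TightCutsTrivial g S Q)
    (hx : x ∉ S) {e f : E} {y z z' : V} (he : Joins g e x y) (hyX : y ∈ X) (hyY : y ∈ Y)
    (hzS : z ∈ S) (hzX : z ∉ X) (hzY : z ∈ Y) (hf : Joins g f x z') (hzS' : z' ∈ S) (hzX' : z' ∈ X)
    (hzY' : z' ∉ Y) :
    (∀ h ∈ boundary g (X ∩ Y), h ∈ boundary g (X ∪ Y) → h = e) ∧
      ∀ w ∈ X, w ∉ Y → (boundary g {w}).Nonempty → w = z' := by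
  have h1 := card_boundary_diff_add_diff (g := g) X Y
  have h2 := hcut (X \ Y) ⟨z', hzS', hzX', hzY'⟩ ⟨z, hzS, fun hc => hzX hc.1⟩
  have h3 := hcut (Y \ X) ⟨z, hzS, hzY, hzX⟩ ⟨z', hzS', fun hc => hzY' hc.1⟩
  have h4 := hX.card_le
  have h5 := hY.card_le
  have hxU : x ∉ X ∪ Y := fun hc => hc.elim hX.notMem hY.notMem
  have hmem : e ∈ boundary g (X ∩ Y) ∩ boundary g (X ∪ Y) := mem_inter.2
    ⟨he.symm.mem_boundary_of_mem ⟨hyX, hyY⟩ fun hc => hX.notMem hc.1,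
      he.symm.mem_boundary_of_mem (Or.inl hyX) hxU⟩
  have h6 := card_pos.2 ⟨e, hmem⟩
  refine ⟨fun h h7 h8 => ?_, fun w hwX hwY hw => ?_⟩
  · exact card_le_one.1 (by omega) h (mem_inter.2 ⟨h7, h8⟩) e hmem
  · obtain ⟨s, hs, -, hz⟩ := hT (X \ Y) ⟨z', hzS', hzX', hzY'⟩ ⟨z, hzS, fun hc => hzX hc.1⟩
      (by omega)
    rcases hz with hz | hz
    · have key : ∀ u ∈ X \ Y, (boundary g {u}).Nonempty → u = s := by
        intro u hu hne
        by_contra hus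
        exact hne.ne_empty (hz u hu hus)
      rw [key w ⟨hwX, hwY⟩ hw, key z' ⟨hzX', hzY'⟩
        ⟨f, hf.symm.mem_boundary_of_mem rfl
          fun hc => hX.notMem (Set.mem_singleton_iff.1 hc ▸ hzX')⟩]
    · have hxs : x ≠ s := fun hc => hx (hc ▸ hs)
      have := hz x (fun hc => hX.notMem hc.1) hxs
      have h9 : e ∈ boundary g {x} := he.mem_boundary_of_mem rfl
        fun hc => hX.notMem (Set.mem_singleton_iff.1 hc ▸ hyX)
      rw [this] at h9
      exact absurd h9 (notMem_empty e)

/-- The dangerous sets containing the end of an edge `e` at `x` cannot cover all edges at `x`. -/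
theorem exists_splittable [Finite V] (hcut : CutBound g S Q) (hT : TightCutsTrivial g S Q)
    (hQ : 2 ≤ Q) {x : V} (hx : x ∉ S) {o : E → V}
    (ho : ∀ f ∈ boundary g {x}, Joins g f x (o f) ∧ o f ≠ x ∧ o f ∈ S) {e : E}
    (he : e ∈ boundary g {x}) (h2 : 2 ≤ #(boundary g {x})) (h3 : #(boundary g {x}) ≠ 3)
    (hmul : (∃ e' ∈ boundary g {x}, e' ≠ e ∧ o e' = o e) ∨
      Set.InjOn o (boundary g {x})) :
    ∃ f ∈ boundary g {x}, f ≠ e ∧ ∀ X, IsDangerous g S Q x X → o e ∈ X → o f ∉ X := by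
  by_contra hcon
  push Not at hcon
  choose! Z hZ hZe hZf using hcon
  set D := boundary g {x} with hD
  have htr : ∀ X, IsDangerous g S Q x X → 2 * #{f ∈ D | o f ∈ X} ≤ #D + 1 := by
    intro X hX
    have h1 := card_boundary_union_singleton (g := g) hX.notMem
    obtain ⟨s, hs, hsX⟩ := hX.exists_mem
    obtain ⟨t, ht, htX⟩ := hX.exists_notMem
    have h2 := hcut (X ∪ {x}) ⟨s, hs, Or.inl hsX⟩ ⟨t, ht, by
      rintro (h3 | h3)
      · exact htX h3
      · exact hx (Set.mem_singleton_iff.1 h3 ▸ ht)⟩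
    have h3 : #{f ∈ D | o f ∈ X} ≤ #(boundary g X ∩ boundary g {x}) := by
      refine card_le_card fun f hf => ?_
      obtain ⟨hf1, hf2⟩ := mem_filter.1 hf
      exact mem_inter.2 ⟨(ho f hf1).1.symm.mem_boundary_of_mem hf2 hX.notMem, hf1⟩
    have h4 := hX.card_le
    rw [← hD] at h1 h3
    omega
  obtain ⟨f₀, hf₀, hne₀⟩ := exists_mem_ne (show 1 < #D by omega) e
  have hpair : ∀ X : Set V, o e ∈ X → ∀ f ∈ D, f ≠ e → o f ∈ X → 2 ≤ #{f ∈ D | o f ∈ X} := by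
    intro X h1 f hf hfe h2
    refine Finset.one_lt_card.2 ⟨e, mem_filter.2 ⟨he, h1⟩, f, mem_filter.2 ⟨hf, h2⟩, hfe.symm⟩
  have hD4 : 4 ≤ #D := by
    have := htr _ (hZ f₀ hf₀ hne₀)
    have := hpair _ (hZe f₀ hf₀ hne₀) f₀ hf₀ hne₀ (hZf f₀ hf₀ hne₀)
    omega
  obtain ⟨X, hXmem, hXmax⟩ := (Set.toFinite {X | IsDangerous g S Q x X ∧ o e ∈ X}).exists_maximalFor
    (fun X => #{f ∈ D | o f ∈ X}) _ ⟨Z f₀, hZ f₀ hf₀ hne₀, hZe f₀ hf₀ hne₀⟩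
  obtain ⟨hX, heX⟩ := hXmem
  have hmax : ∀ Y, IsDangerous g S Q x Y → o e ∈ Y →
      #{f ∈ D | o f ∈ Y} ≤ #{f ∈ D | o f ∈ X} := by
    intro Y hY heY
    by_contra hc
    exact hc (hXmax ⟨hY, heY⟩ (by simpa using (not_le.1 hc).le))
  have hle2 : #{f ∈ D | o f ∈ X} ≤ 2 ∧ Set.InjOn o D := by
    obtain ⟨f, hf, hfX⟩ : ∃ f ∈ D, o f ∉ X := by
      by_contra! hc
      have := htr X hX
      rw [filter_true_of_mem hc] at this
      omega
    have hfe : f ≠ e := fun hc => hfX (hc ▸ heX)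
    have hY := hZ f hf hfe
    have heY := hZe f hf hfe
    have hfY := hZf f hf hfe
    obtain ⟨f', hf', hfY'⟩ : ∃ f' ∈ ({f ∈ D | o f ∈ X} : Finset E),
        f' ∉ ({h ∈ D | o h ∈ Z f} : Finset E) := by
      by_contra! hc
      have h5 : ({f ∈ D | o f ∈ X} : Finset E) ⊂ ({h ∈ D | o h ∈ Z f} : Finset E) :=
        (ssubset_iff_of_subset hc).2 ⟨f, mem_filter.2 ⟨hf, hfY⟩, fun h => hfX (mem_filter.1 h).2⟩
      have := card_lt_card h5
      have := hmax _ hY heY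
      omega
    obtain ⟨hfD', hfX'⟩ := mem_filter.1 hf'
    have hfZ' : o f' ∉ Z f := fun hc => hfY' (mem_filter.2 ⟨hfD', hc⟩)
    obtain ⟨hA, hB⟩ := hX.uncrossing hY hcut hT hx (ho e he).1 heX heY (ho f hf).2.2 hfX hfY
      (ho f' hfD').1 (ho f' hfD').2.2 hfX' hfZ'
    have hAD : ∀ h ∈ D, o h ∈ X → o h ∈ Z f → h = e := by
      intro h hh h1 h2
      refine hA h ((ho h hh).1.symm.mem_boundary_of_mem ⟨h1, h2⟩ fun hc => hX.notMem hc.1)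
        ((ho h hh).1.symm.mem_boundary_of_mem (Or.inl h1) ?_)
      rintro (hc | hc)
      · exact hX.notMem hc
      · exact hY.notMem hc
    have hinj : Set.InjOn o D := by
      refine hmul.resolve_left ?_
      rintro ⟨e', he', hne, heq⟩
      exact hne (hAD e' he' (heq ▸ heX) (heq ▸ heY))
    refine ⟨?_, hinj⟩
    have hsub : ({f ∈ D | o f ∈ X} : Finset E) ⊆ {e, f'} := by
      intro h hh
      obtain ⟨hhD, hhX⟩ := mem_filter.1 hh
      by_cases hhY : o h ∈ Z f
      · simp [hAD h hhD hhX hhY]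
      · have := hB (o h) hhX hhY
          ⟨h, (ho h hhD).1.symm.mem_boundary_of_mem rfl fun hc => (ho h hhD).2.1 hc.symm⟩
        simp [hinj hhD hfD' this]
    exact (card_le_card hsub).trans card_le_two
  obtain ⟨hle2, hinj⟩ := hle2
  have huniq : ∀ f ∈ D, f ≠ e → ∀ f' ∈ D, f' ≠ e → f' ≠ f → o f' ∉ Z f := by
    intro f hf hfe f' hf' hfe' hne hc
    have h5 := (hmax _ (hZ f hf hfe) (hZe f hf hfe)).trans hle2
    have h6 : ({e, f, f'} : Finset E) ⊆ ({h ∈ D | o h ∈ Z f} : Finset E) := by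
      intro h hh
      simp only [mem_insert, mem_singleton] at hh
      rcases hh with rfl | rfl | rfl
      · exact mem_filter.2 ⟨he, hZe f hf hfe⟩
      · exact mem_filter.2 ⟨hf, hZf _ hf hfe⟩
      · exact mem_filter.2 ⟨hf', hc⟩
    have h7 := card_le_card h6
    rw [card_eq_three.2 ⟨e, f, f', hfe.symm, hfe'.symm, hne.symm, rfl⟩] at h7
    omega
  obtain ⟨f₁, f₂, f₃, h₁, h₂, h₃, h₁₂, h₁₃, h₂₃⟩ : ∃ a b c, a ∈ D.erase e ∧ b ∈ D.erase e ∧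
      c ∈ D.erase e ∧ a ≠ b ∧ a ≠ c ∧ b ≠ c := by
    have : 2 < #(D.erase e) := by rw [card_erase_of_mem he]; omega
    obtain ⟨a, b, c, ha, hb, hc, h⟩ := two_lt_card_iff.1 this
    exact ⟨a, b, c, ha, hb, hc, h⟩
  have hcross : ∀ f ∈ D, f ≠ e → ∀ f' ∈ D, f' ≠ e → f' ≠ f →
      (∀ h ∈ boundary g (Z f ∩ Z f'), h ∈ boundary g (Z f ∪ Z f') → h = e) ∧
        ∀ w ∈ Z f, w ∉ Z f' → (boundary g {w}).Nonempty → w = o f := by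
    intro f hf hfe f' hf' hfe' hne
    exact (hZ f hf hfe).uncrossing (hZ f' hf' hfe') hcut hT hx (ho e he).1 (hZe f hf hfe)
      (hZe f' hf' hfe') (ho f' hf').2.2 (huniq f hf hfe f' hf' hfe' hne) (hZf f' hf' hfe')
      (ho f hf).1 (ho f hf).2.2 (hZf f hf hfe) (huniq f' hf' hfe' f hf hfe hne.symm)
  obtain ⟨hne₁, hD₁⟩ := mem_erase.1 h₁
  obtain ⟨hne₂, hD₂⟩ := mem_erase.1 h₂
  obtain ⟨hne₃, hD₃⟩ := mem_erase.1 h₃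
  have half : ∀ f ∈ D, f ≠ e → ∀ f' ∈ D, f' ≠ e → f' ≠ f → f ≠ f₃ → f' ≠ f₃ →
      ∀ h a b, Joins g h a b → a ∈ Z f → a ∈ Z f' → b ∈ Z f → b ∉ Z f' → h = e := by
    intro f hf hfe f' hf' hfe' hne hf3 hf3' h a b hj ha ha' hb hb'
    have hab : a ≠ b := fun hc => hb' (hc ▸ ha')
    have ha3 : a ∈ Z f₃ := by
      by_contra hc
      have := (hcross f hf hfe f₃ hD₃ hne₃ hf3.symm).2 a ha hc
        ⟨h, hj.mem_boundary_of_mem rfl hab.symm⟩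
      exact huniq f' hf' hfe' f hf hfe hne.symm (this ▸ ha')
    have hbo := (hcross f hf hfe f' hf' hfe' hne).2 b hb hb'
      ⟨h, hj.symm.mem_boundary_of_mem rfl hab⟩
    have hb3 : b ∉ Z f₃ := hbo ▸ huniq f₃ hD₃ hne₃ f hf hfe hf3
    refine (hcross f' hf' hfe' f₃ hD₃ hne₃ hf3'.symm).1 h
      (hj.mem_boundary_of_mem ⟨ha', ha3⟩ fun hc => hb3 hc.2)
      (hj.mem_boundary_of_mem (Or.inl ha') fun hc => hc.elim hb' hb3)
  have hsub : boundary g (Z f₁ ∩ Z f₂) ⊆ {e} := by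
    intro h hh
    rw [mem_singleton]
    obtain ⟨a, b, hj, ha, hb⟩ := exists_joins_of_mem_boundary hh
    by_cases hb1 : b ∈ Z f₁
    · exact half f₁ hD₁ hne₁ f₂ hD₂ hne₂ h₁₂.symm h₁₃ h₂₃ h a b hj ha.1 ha.2 hb1
        fun hc => hb ⟨hb1, hc⟩
    by_cases hb2 : b ∈ Z f₂
    · exact half f₂ hD₂ hne₂ f₁ hD₁ hne₁ h₁₂ h₂₃ h₁₃ h a b hj ha.2 ha.1 hb2 hb1
    · exact (hcross f₁ hD₁ hne₁ f₂ hD₂ hne₂ h₁₂.symm).1 h hh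
        (hj.mem_boundary_of_mem (Or.inl ha.1) fun hc => hc.elim hb1 hb2)
  have hlast := card_le_card hsub
  have := hcut (Z f₁ ∩ Z f₂) ⟨o e, (ho e he).2.2, hZe f₁ hD₁ hne₁, hZe f₂ hD₂ hne₂⟩
    ⟨o f₁, (ho f₁ hD₁).2.2, fun hc => huniq f₂ hD₂ hne₂ f₁ hD₁ hne₁ h₁₂ hc.2⟩
  rw [card_singleton] at hlast
  omega

/-- A vertex outside `S` whose degree is neither one nor three is reducible. -/
theorem IsRooted.hasBalancedPacking_of_degree [Finite V] (h : IsRooted Q g S v pc)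
    (hT : TightCutsTrivial g S Q) (hQ : 2 ≤ Q) {x : V} (hx : x ∉ S)
    (hnb : ∀ e y, Joins g e x y → y ≠ x → y ∈ S)
    (h2 : 2 ≤ #(boundary g {x})) (h3 : #(boundary g {x}) ≠ 3)
    (ih : ∀ (g' : E → V × V) (S' : Set V) (v' : V) (pc' : E → Fin k),
      #(properEdges g') < #(properEdges g) → IsRooted Q g' S' v' pc' →
        HasBalancedPacking g' S' v' pc') :
    HasBalancedPacking g S v pc := by
  have ho : ∀ f ∈ boundary g {x}, ∃ y, Joins g f x y ∧ y ≠ x ∧ y ∈ S := by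
    intro f hf
    obtain ⟨y, hy, hj⟩ := mem_boundary_singleton.1 hf
    exact ⟨y, hj, hy, hnb f y hj hy⟩
  have : Nonempty V := ⟨x⟩
  choose! o ho using ho
  obtain ⟨e, he, hmul⟩ : ∃ e ∈ boundary g {x},
      (∃ e' ∈ boundary g {x}, e' ≠ e ∧ o e' = o e) ∨ Set.InjOn o (boundary g {x}) := by
    by_cases hinj : Set.InjOn o (boundary g {x})
    · obtain ⟨e, he⟩ := card_pos.1 (by omega : 0 < #(boundary g {x}))
      exact ⟨e, he, Or.inr hinj⟩
    · simp only [Set.InjOn] at hinj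
      push Not at hinj
      obtain ⟨a, ha, b, hb, hab, hne⟩ := hinj
      exact ⟨b, hb, Or.inl ⟨a, ha, hne, hab⟩⟩
  obtain ⟨f, hf, hfe, hsafe⟩ := exists_splittable h.cut hT hQ hx ho he h2 h3 hmul
  have hsafe' : ∀ X : Set V, (∃ s ∈ S, s ∈ X) → (∃ s ∈ S, s ∉ X) → x ∉ X → o e ∈ X → o f ∈ X →
      Q + 2 ≤ #(boundary g X) := by
    intro X h4 h5 hxX heX hfX
    by_contra hc
    exact hsafe X ⟨h4, h5, hxX, by omega⟩ heX hfX
  obtain ⟨hej, hex, heS⟩ := ho e he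
  obtain ⟨hfj, hfx, hfS⟩ := ho f hf
  by_cases hoo : o e = o f
  · have key : ∀ X : Set V, (∃ s ∈ S, s ∈ X) → (∃ s ∈ S, s ∉ X) → x ∉ X → o e ∈ X →
        Q + 1 ≤ #(boundary g X) := by
      intro X h4 h5 hxX heX
      have := hsafe' X h4 h5 hxX heX (hoo ▸ heX)
      omega
    refine h.hasBalancedPacking_of_delete (hej.mem_properEdges_iff.2 hex.symm)
      (fun X h4 h5 heX => ?_) ih
    rw [hej.mem_boundary_iff] at heX
    by_cases hxX : x ∈ X
    · rw [← boundary_compl]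
      obtain ⟨s, hs, hsX⟩ := h4
      exact key Xᶜ h5 ⟨s, hs, fun hc => hc hsX⟩ (fun hc => hc hxX) (by tauto)
    · exact key X h4 h5 hxX (by tauto)
  · by_cases hfv : o f = v
    · exact h.hasBalancedPacking_of_split hfj hej hx hfS heS (Ne.symm hoo)
        (fun hc => hoo (hc.trans hfv.symm)) (fun X h4 h5 h6 h7 h8 => hsafe' X h4 h5 h6 h8 h7) ih
    · exact h.hasBalancedPacking_of_split hej hfj hx heS hfS hoo hfv hsafe' ih

end

section
open Classical Finset

/-- Every vertex outside `S` is isolated or cubic with three different neighbours in `S`. -/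
structure IsReduced {V E : Type} [Fintype E] (g : E → V × V) (S : Set V) : Prop where
  mem : ∀ w ∉ S, ∀ e y, Joins g e w y → y ≠ w → y ∈ S
  unique : ∀ w ∉ S, ∀ e e' y, y ≠ w → Joins g e w y → Joins g e' w y → e = e'
  card : ∀ w ∉ S, #(boundary g {w}) = 0 ∨ #(boundary g {w}) = 3

/-- The vertex `y` of `S` is an end of `e`, and `e` belongs to the hyperedge `j`, where a hyperedge
is either an edge inside `S` or the neighbourhood of a vertex outside `S`. -/
def IsPart {V E : Type} (g : E → V × V) (S : Set V) (e : E) (y : V) : E ⊕ V → Prop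
  | Sum.inl e' => e' = e ∧ y ∈ S ∧ ∃ b ∈ S, b ≠ y ∧ Joins g e y b
  | Sum.inr w => w ∉ S ∧ y ∈ S ∧ Joins g e w y

/-- The vertices of a hyperedge. -/
noncomputable def hyperedge {V E : Type} [Fintype V] (g : E → V × V) (S : Set V) (j : E ⊕ V) :
    Finset V :=
  univ.filter fun y => ∃ e, IsPart g S e y j

variable {V E : Type} {g : E → V × V} {S : Set V}

theorem mem_hyperedge [Fintype V] {j : E ⊕ V} {y : V} :
    y ∈ hyperedge g S j ↔ ∃ e, IsPart g S e y j := by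
  simp [hyperedge]

theorem IsPart.mem {e : E} {y : V} {j : E ⊕ V} (h : IsPart g S e y j) : y ∈ S := by
  rcases j with e' | w
  · exact h.2.1
  · exact h.2.1

theorem eq_or_eq_of_mem_hyperedge [Fintype V] {e : E} {a b : V} {e' : E} (hj : Joins g e a b)
    (h : e' = e) {y : V} (hy : y ∈ hyperedge g S (Sum.inl e')) : y = a ∨ y = b := by
  obtain ⟨e'', h1, -, c, -, -, hj'⟩ := mem_hyperedge.1 hy
  subst h1
  subst h
  rcases hj.unique hj' with h | h
  · exact Or.inl h.1.symm
  · exact Or.inr h.2.symm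

theorem card_hyperedge_inl_le [Fintype V] (e : E) : #(hyperedge g S (Sum.inl e)) ≤ 2 := by
  have : hyperedge g S (Sum.inl e) ⊆ {(g e).1, (g e).2} := by
    intro y hy
    simpa using eq_or_eq_of_mem_hyperedge (joins_self e) rfl hy
  exact (card_le_card this).trans card_le_two

theorem card_hyperedge_inl_ne [Fintype V] (e : E) : #(hyperedge g S (Sum.inl e)) ≠ 1 := by
  intro h
  obtain ⟨y, hy⟩ := card_eq_one.1 h
  have hmem : y ∈ hyperedge g S (Sum.inl e) := by simp [hy]
  obtain ⟨e', h1, h2, b, hb, hne, hj⟩ := mem_hyperedge.1 hmem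
  have : b ∈ hyperedge g S (Sum.inl e) :=
    mem_hyperedge.2 ⟨e', h1, hb, y, h2, hne.symm, hj.symm⟩
  rw [hy, mem_singleton] at this
  exact hne this

theorem IsPart.eq {e : E} {y y' : V} {j j' : E ⊕ V} (h : IsPart g S e y j)
    (h' : IsPart g S e y' j') : j = j' := by
  rcases j with f | w <;> rcases j' with f' | w'
  · rw [h.1, h'.1]
  · obtain ⟨-, hy, b, hb, -, hj⟩ := h
    obtain ⟨hw, -, hj'⟩ := h'
    rcases hj.unique hj' with h1 | h1
    · exact absurd (h1.1 ▸ hy) hw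
    · exact absurd (h1.2 ▸ hb) hw
  · obtain ⟨-, hy, b, hb, -, hj⟩ := h'
    obtain ⟨hw, -, hj'⟩ := h
    rcases hj.unique hj' with h1 | h1
    · exact absurd (h1.1 ▸ hy) hw
    · exact absurd (h1.2 ▸ hb) hw
  · rcases h.2.2.unique h'.2.2 with h1 | h1
    · rw [h1.1]
    · exact absurd (h1.1 ▸ h'.2.1) h.1

variable [Fintype E]

theorem IsPart.mem_boundary {e : E} {y : V} {j : E ⊕ V} (h : IsPart g S e y j) :
    e ∈ boundary g {y} := by
  rcases j with e' | w
  · obtain ⟨-, -, b, -, hne, hj⟩ := h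
    exact hj.mem_boundary_of_mem rfl hne
  · obtain ⟨hw, hy, hj⟩ := h
    exact hj.symm.mem_boundary_of_mem rfl fun hc => hw (Set.mem_singleton_iff.1 hc ▸ hy)

theorem exists_isPart {e : E} {y : V} (he : e ∈ boundary g {y}) (hy : y ∈ S) :
    ∃ j, IsPart g S e y j := by
  obtain ⟨b, hb, hj⟩ := mem_boundary_singleton.1 he
  by_cases hbS : b ∈ S
  · exact ⟨Sum.inl e, rfl, hy, b, hbS, hb, hj⟩
  · exact ⟨Sum.inr b, hbS, hy, hj.symm⟩

theorem IsReduced.exists_isPart_of_mem_properEdges (hR : IsReduced g S) {e : E}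
    (he : e ∈ properEdges g) : ∃ j y, IsPart g S e y j := by
  have hne := mem_properEdges.1 he
  by_cases h1 : (g e).1 ∈ S
  · obtain ⟨j, hj⟩ := exists_isPart ((joins_self e).mem_boundary_of_mem rfl hne.symm) h1
    exact ⟨j, _, hj⟩
  · exact ⟨Sum.inr (g e).1, (g e).2, h1, hR.mem _ h1 e _ (joins_self e) hne.symm, joins_self e⟩

theorem IsReduced.eq_of_isPart (hR : IsReduced g S) {e e' : E} {y : V} {j : E ⊕ V}
    (h : IsPart g S e y j) (h' : IsPart g S e' y j) : e = e' := by
  rcases j with f | w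
  · rw [← h.1, ← h'.1]
  · exact hR.unique w h.1 e e' y (fun hc => h.1 (hc ▸ h.2.1)) h.2.2 h'.2.2

theorem IsPart.mem_boundary_or {e e' : E} {a b : V} {j : E ⊕ V} (ha : IsPart g S e a j)
    (hb : IsPart g S e' b j) {X : Set V} (hX : ¬ (a ∈ X ↔ b ∈ X)) :
    e ∈ boundary g X ∨ e' ∈ boundary g X := by
  rcases j with f | w
  · obtain ⟨rfl, -, c, -, hca, hj⟩ := ha
    obtain ⟨rfl, -, d, -, hdb, hj'⟩ := hb
    left
    rw [hj.mem_boundary_iff]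
    rcases hj.unique hj' with h | h
    · rw [h.1] at hX; tauto
    · rw [h.2]; exact hX
  · rw [ha.2.2.mem_boundary_iff, hb.2.2.mem_boundary_iff]
    tauto

theorem IsPart.notMem_boundary [Fintype V] {e : E} {a b v : V} {j : E ⊕ V}
    (ha : IsPart g S e a j) (hv : v ∈ S) (hav : a ≠ v) (hb : b ∈ hyperedge g S j) (hbv : b ≠ v)
    (hab : a ≠ b) : e ∉ boundary g {v} := by
  intro he
  obtain ⟨y, hyv, hj⟩ := mem_boundary_singleton.1 he
  rcases j with f | w
  · obtain ⟨h1, -, c, -, -, hj'⟩ := ha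
    have h2 := eq_or_eq_of_mem_hyperedge hj h1 hb
    rcases hj.unique hj' with h | h
    · exact hav h.1.symm
    · rcases h2 with h2 | h2
      · exact hbv h2
      · exact hab (h2.trans h.2).symm
  · obtain ⟨hw, -, hj'⟩ := ha
    rcases hj.unique hj' with h | h
    · exact hw (h.1 ▸ hv)
    · exact hav h.1.symm

theorem IsReduced.card_hyperedge_inr [Fintype V] (hR : IsReduced g S) (w : V) :
    #(hyperedge g S (Sum.inr w : E ⊕ V)) = 0 ∨ #(hyperedge g S (Sum.inr w : E ⊕ V)) = 3 := by
  by_cases hw : w ∈ S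
  · left
    rw [card_eq_zero]
    refine eq_empty_of_forall_notMem fun y hy => ?_
    obtain ⟨e, h, -⟩ := mem_hyperedge.1 hy
    exact h hw
  · have ho : ∀ f ∈ boundary g {w}, ∃ y, Joins g f w y ∧ y ≠ w ∧ y ∈ S := by
      intro f hf
      obtain ⟨y, hy, hj⟩ := mem_boundary_singleton.1 hf
      exact ⟨y, hj, hy, hR.mem w hw f y hj hy⟩
    have : Nonempty V := ⟨w⟩
    choose! o ho using ho
    have himg : hyperedge g S (Sum.inr w : E ⊕ V) = (boundary g {w}).image o := by
      ext y
      rw [mem_hyperedge, mem_image]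
      constructor
      · rintro ⟨e, h1, h2, hj⟩
        have hwy : w ≠ y := fun hc => h1 (hc ▸ h2)
        have he : e ∈ boundary g {w} := hj.mem_boundary_of_mem rfl hwy.symm
        refine ⟨e, he, ?_⟩
        rcases hj.unique (ho e he).1 with h | h
        · exact h.2.symm
        · exact absurd h.2.symm hwy
      · rintro ⟨e, he, rfl⟩
        exact ⟨e, hw, (ho e he).2.2, (ho e he).1⟩
    rw [himg, card_image_of_injOn]
    · exact hR.card w hw
    · intro a ha b hb hab
      exact hR.unique w hw a b (o a) (ho a ha).2.1 (ho a ha).1 (hab ▸ (ho b hb).1)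

theorem IsReduced.card_boundary_le [Fintype V] (hR : IsReduced g S) (Z : Finset V)
    (hZ : ∀ z ∈ Z, z ∈ S) {X : Set V}
    (hX : X = {z | z ∈ Z ∨ z ∉ S ∧ 2 ≤ #(hyperedge g S (Sum.inr z : E ⊕ V) ∩ Z)}) :
    #(boundary g X) ≤ #{j : E ⊕ V | (hyperedge g S j ∩ Z).Nonempty ∧ ¬ hyperedge g S j ⊆ Z} := by
  have hXZ : ∀ y ∈ S, y ∈ X ↔ y ∈ Z := by
    intro y hy
    simp [hX, hy]
  have hXw : ∀ w ∉ S, w ∈ X ↔ 2 ≤ #(hyperedge g S (Sum.inr w : E ⊕ V) ∩ Z) := by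
    intro w hw
    have : w ∉ Z := fun hc => hw (hZ w hc)
    simp [hX, hw, this]
  have hpart : ∀ e ∈ boundary g X, ∃ j y, IsPart g S e y j := by
    intro e he
    refine hR.exists_isPart_of_mem_properEdges (mem_properEdges.2 fun hc => ?_)
    rw [SteinerPacking.mem_boundary, hc] at he
    exact he Iff.rfl
  by_cases hE : IsEmpty V
  · have : boundary g X = ∅ := eq_empty_of_forall_notMem fun e he => hE.elim (g e).1
    simp [this]
  rw [not_isEmpty_iff] at hE
  have : ∀ e, Nonempty (E ⊕ V) := fun e => ⟨Sum.inl e⟩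
  by_cases hEE : IsEmpty E
  · have : boundary g X = ∅ := eq_empty_of_forall_notMem fun e he => hEE.elim e
    simp [this]
  rw [not_isEmpty_iff] at hEE
  have : Nonempty (E ⊕ V) := ⟨Sum.inl hEE.some⟩
  choose! J Y hJ using hpart
  refine card_le_card_of_injOn J (fun e he => ?_) fun e he e' he' heq => ?_
  · have h1 := hJ e he
    refine mem_coe.2 (mem_filter.2 ⟨mem_univ _, ?_⟩)
    generalize J e = j at h1
    generalize Y e = y at h1
    rcases j with f | w
    · obtain ⟨rfl, hy, b, hb, hby, hj⟩ := h1
      have h2 : y ∈ hyperedge g S (Sum.inl f) := mem_hyperedge.2 ⟨f, rfl, hy, b, hb, hby, hj⟩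
      have h3 : b ∈ hyperedge g S (Sum.inl f) :=
        mem_hyperedge.2 ⟨f, rfl, hb, y, hy, hby.symm, hj.symm⟩
      rw [mem_coe, hj.mem_boundary_iff, hXZ y hy, hXZ b hb] at he
      by_cases hyZ : y ∈ Z
      · exact ⟨⟨y, mem_inter.2 ⟨h2, hyZ⟩⟩, fun hc => he ⟨fun _ => hc h3, fun _ => hyZ⟩⟩
      · exact ⟨⟨b, mem_inter.2 ⟨h3, by tauto⟩⟩, fun hc => hyZ (hc h2)⟩
    · have h2 : y ∈ hyperedge g S (Sum.inr w : E ⊕ V) := mem_hyperedge.2 ⟨e, h1⟩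
      obtain ⟨hw, hy, hj⟩ := h1
      rw [mem_coe, hj.mem_boundary_iff, hXZ y hy, hXw w hw] at he
      by_cases hyZ : y ∈ Z
      · refine ⟨⟨y, mem_inter.2 ⟨h2, hyZ⟩⟩, fun hc => he ⟨fun _ => hyZ, fun _ => ?_⟩⟩
        rw [inter_eq_left.2 hc]
        have := card_pos.2 ⟨y, h2⟩
        have := hR.card_hyperedge_inr w
        omega
      · exact ⟨card_pos.1 (by have : 2 ≤ #(hyperedge g S (Sum.inr w : E ⊕ V) ∩ Z) := by tauto
                              omega), fun hc => hyZ (hc h2)⟩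
  · have h1 := hJ e he
    have h1' := hJ e' he'
    rw [← heq] at h1'
    generalize J e = j at h1 h1'
    generalize Y e = y at h1
    generalize Y e' = y' at h1'
    rcases j with f | w
    · rw [← h1.1, ← h1'.1]
    · by_cases hyy : y = y'
      · exact hR.eq_of_isPart h1 (hyy ▸ h1')
      exfalso
      have h2 : y ∈ hyperedge g S (Sum.inr w : E ⊕ V) := mem_hyperedge.2 ⟨e, h1⟩
      have h2' : y' ∈ hyperedge g S (Sum.inr w : E ⊕ V) := mem_hyperedge.2 ⟨e', h1'⟩
      obtain ⟨hw, hy, hj⟩ := h1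
      obtain ⟨-, hy', hj'⟩ := h1'
      rw [mem_coe, hj.mem_boundary_iff, hXZ y hy] at he
      rw [mem_coe, hj'.mem_boundary_iff, hXZ y' hy'] at he'
      have h3 := card_inter_add_card_sdiff (hyperedge g S (Sum.inr w : E ⊕ V)) Z
      have h4 := hR.card_hyperedge_inr w
      by_cases hwX : w ∈ X
      · have h5 := (hXw w hw).1 hwX
        have h6 : ({y, y'} : Finset V) ⊆ hyperedge g S (Sum.inr w : E ⊕ V) \ Z := by
          intro u hu
          rw [mem_insert, mem_singleton] at hu
          rcases hu with rfl | rfl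
          · exact mem_sdiff.2 ⟨h2, by tauto⟩
          · exact mem_sdiff.2 ⟨h2', by tauto⟩
        have h7 := card_le_card h6
        rw [card_pair hyy] at h7
        omega
      · have h6 : ({y, y'} : Finset V) ⊆ hyperedge g S (Sum.inr w : E ⊕ V) ∩ Z := by
          intro u hu
          rw [mem_insert, mem_singleton] at hu
          rcases hu with rfl | rfl
          · exact mem_inter.2 ⟨h2, by tauto⟩
          · exact mem_inter.2 ⟨h2', by tauto⟩
        have h7 := card_le_card h6
        rw [card_pair hyy] at h7
        exact hwX ((hXw w hw).2 h7)

end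

section
open Classical Finset

theorem exists_surjOn_of_card_le {α β : Type} [Nonempty α] {A : Finset α} {B : Finset β}
    (h : #A ≤ #B) : ∃ q : β → α, ∀ a ∈ A, ∃ b ∈ B, q b = a := by
  obtain ⟨φ⟩ := Function.Embedding.nonempty_of_card_le (α := A) (β := B) (by simpa using h)
  have hinj : Function.Injective fun a : A => (φ a : β) :=
    Subtype.val_injective.comp φ.injective
  by_cases hA : Nonempty A
  · refine ⟨fun b => (Function.invFun (fun a : A => (φ a : β)) b : A), fun a ha => ?_⟩
    exact ⟨φ ⟨a, ha⟩, (φ ⟨a, ha⟩).2, 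
      congrArg Subtype.val (Function.leftInverse_invFun hinj ⟨a, ha⟩)⟩
  · exact ⟨fun _ => Classical.arbitrary α, fun a ha => absurd ⟨⟨a, ha⟩⟩ hA⟩

variable {V E : Type} [Fintype V] [Fintype E] {k Q : ℕ} {g : E → V × V} {S : Set V} {v : V}
  {pc : E → Fin k}

/-- The extension theorem for reduced multigraphs. -/
theorem IsRooted.hasBalancedPacking_of_isReduced (h : IsRooted Q g S v pc) (hR : IsReduced g S)
    (hk : 0 < k) (hQ : 7 * k ≤ Q) : HasBalancedPacking g S v pc := by
  have hpos : Nonempty (Fin k) := ⟨⟨0, hk⟩⟩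
  obtain ⟨c, hc⟩ : ∃ c : E ⊕ V → Fin k, ∀ e j, IsPart g S e v j → c j = pc e := by
    have : ∀ j, ∃ i : Fin k, ∀ e, IsPart g S e v j → i = pc e := by
      intro j
      by_cases hj : ∃ e, IsPart g S e v j
      · obtain ⟨e, he⟩ := hj
        exact ⟨pc e, fun e' he' => by rw [hR.eq_of_isPart he he']⟩
      · exact ⟨hpos.some, fun e he => absurd ⟨e, he⟩ hj⟩
    choose c hc using this
    exact ⟨c, fun e j => hc j e⟩
  have hN1 : ∀ j : E ⊕ V, #(hyperedge g S j) ≠ 1 := by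
    rintro (e | w)
    · exact card_hyperedge_inl_ne e
    · have := hR.card_hyperedge_inr w
      omega
  have hN3 : ∀ j : E ⊕ V, #(hyperedge g S j) ≤ 3 := by
    rintro (e | w)
    · exact (card_hyperedge_inl_le e).trans (by omega)
    · have := hR.card_hyperedge_inr w
      omega
  have hpt : ∀ y j, y ∈ hyperedge g S j → ∃ e, IsPart g S e y j := fun y j hy => mem_hyperedge.1 hy
  have hE : ∀ e ∈ boundary g {v}, ∃ j, IsPart g S e v j := fun e he => exists_isPart he h.mem
  have hEne : Nonempty E := by
    have : 0 < #(boundary g {v}) := by rw [h.card]; omega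
    obtain ⟨e, -⟩ := card_pos.1 this
    exact ⟨e⟩
  have hIne : Nonempty (E ⊕ V) := ⟨Sum.inr v⟩
  have hmemS : ∀ y j, y ∈ hyperedge g S j → y ∈ S := by
    intro y j hy
    obtain ⟨e, he⟩ := hpt y j hy
    exact he.mem
  obtain ⟨sel, hsub, hone, hconn, hres⟩ := exists_hypergraph_packing hk hQ S.toFinset v
    (Set.mem_toFinset.2 h.mem)
    (by obtain ⟨s, hs, hsv⟩ := h.exists_ne; exact ⟨s, Set.mem_toFinset.2 hs, hsv⟩)
    (hyperedge g S) (fun j y hy => Set.mem_toFinset.2 (hmemS y j hy)) hN3 hN1 c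
    (by
      intro Z hZS hZ hZne
      have hZS' : ∀ z ∈ Z, z ∈ S := fun z hz => Set.mem_toFinset.1 (hZS hz)
      refine (h.cut _ ?_ ?_).trans (hR.card_boundary_le Z hZS' rfl)
      · obtain ⟨z, hz⟩ := hZ
        exact ⟨z, hZS' z hz, Or.inl hz⟩
      · obtain ⟨z, hz, hzZ⟩ := exists_of_ssubset (hZS.ssubset_of_ne hZne)
        rw [Set.mem_toFinset] at hz
        refine ⟨z, hz, ?_⟩
        rintro (h1 | h1)
        · exact hzZ h1
        · exact h1.1 hz)
    (by
      rw [← h.card]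
      have := hpt v
      choose! D hD using this
      refine card_le_card_of_injOn D (fun j hj => ?_) fun j hj j' hj' heq => ?_
      · exact mem_coe.2 (hD j (mem_filter.1 (mem_coe.1 hj)).2).mem_boundary
      · have h1 := hD j (mem_filter.1 (mem_coe.1 hj)).2
        have h2 := hD j' (mem_filter.1 (mem_coe.1 hj')).2
        rw [heq] at h1
        exact h1.eq h2)
    (by
      intro i
      refine (h.two_le i).trans ?_
      choose! J hJ using hE
      refine card_le_card_of_injOn J (fun e he => ?_) fun e he e' he' heq => ?_
      · obtain ⟨h1, h2⟩ := mem_filter.1 (mem_coe.1 he)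
        exact mem_coe.2 (mem_filter.2 ⟨mem_univ _, mem_hyperedge.2 ⟨e, hJ e h1⟩,
          (hc e _ (hJ e h1)).trans h2⟩)
      · have h1 := hJ e (mem_filter.1 (mem_coe.1 he)).1
        have h2 := hJ e' (mem_filter.1 (mem_coe.1 he')).1
        rw [heq] at h1
        exact hR.eq_of_isPart h1 h2)
  have hinl : ∀ j i a b, Sum.inl (i, a, b) ∈ sel j → a ∈ hyperedge g S j ∧ b ∈ hyperedge g S j ∧
      a ≠ v ∧ b ≠ v ∧ (v ∈ hyperedge g S j → i = c j) := by
    intro j i a b hj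
    simpa [options] using hsub j hj
  have hinr : ∀ j x, Sum.inr x ∈ sel j → x ∈ hyperedge g S j ∧ x ≠ v ∧
      (v ∈ hyperedge g S j → #(hyperedge g S j) = 3) := by
    intro j x hj
    simpa [options] using hsub j hj
  have hsel : ∀ j o o', o ∈ sel j → o' ∈ sel j → o = o' := fun j o o' ho ho' =>
    card_le_one.1 (hone j) o ho o' ho'
  let P : E → Fin k → Prop := fun e i => ∃ j y, IsPart g S e y j ∧
    (v ∈ hyperedge g S j → i = c j ∧ Sum.inr y ∉ sel j) ∧
    (v ∉ hyperedge g S j → ∃ a b, Sum.inl (i, a, b) ∈ sel j ∧ (y = a ∨ y = b))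
  have hPuniq : ∀ e i i', P e i → P e i' → i = i' := by
    rintro e i i' ⟨j, y, h1, h2, h3⟩ ⟨j', y', h1', h2', h3'⟩
    obtain rfl := h1.eq h1'
    by_cases hv : v ∈ hyperedge g S j
    · rw [(h2 hv).1, (h2' hv).1]
    · obtain ⟨a, b, h4, -⟩ := h3 hv
      obtain ⟨a', b', h4', -⟩ := h3' hv
      have := hsel j _ _ h4 h4'
      simp only [Sum.inl.injEq, Prod.mk.injEq] at this
      exact this.1
  obtain ⟨col, hcolv, hcol⟩ : ∃ col : E → Option (Fin k),
      (∀ e ∈ boundary g {v}, col e = some (pc e)) ∧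
      ∀ e ∉ boundary g {v}, ∀ i, col e = some i ↔ P e i := by
    refine ⟨fun e => if e ∈ boundary g {v} then some (pc e) else
      if hP : ∃ i, P e i then some hP.choose else none, fun e he => by simp [he],
      fun e he i => ?_⟩
    simp only [he, if_false]
    split_ifs with hP
    · rw [Option.some.injEq]
      exact ⟨fun h => h ▸ hP.choose_spec, fun h => hPuniq e _ _ hP.choose_spec h⟩
    · simp only [false_iff]
      exact fun h => hP ⟨i, h⟩
  have hlinked : ∀ i, Linked g (fun e => col e = some i ∧ e ∉ boundary g {v})
      (terminals g S v (fun e => some (pc e)) i) := by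
    rintro i X ⟨x₁, hx₁, hx₁X⟩ ⟨x₂, hx₂, hx₂X⟩
    by_cases hsep : (∃ x ∈ S, x ≠ v ∧ x ∈ X) ∧ ∃ y ∈ S, y ≠ v ∧ y ∉ X
    · obtain ⟨⟨x, hxS, hxv, hxX⟩, y, hyS, hyv, hyX⟩ := hsep
      obtain ⟨j, a, b, hj, hab⟩ := hconn i X ⟨x, Set.mem_toFinset.2 hxS, hxv, hxX⟩
        ⟨y, Set.mem_toFinset.2 hyS, hyv, hyX⟩
      obtain ⟨haN, hbN, hav, hbv, hvi⟩ := hinl j i a b hj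
      obtain ⟨e, he⟩ := hpt a j haN
      obtain ⟨e', he'⟩ := hpt b j hbN
      have hne : a ≠ b := fun hc => hab (hc ▸ Iff.rfl)
      have hev := he.notMem_boundary h.mem hav hbN hbv hne
      have hev' := he'.notMem_boundary h.mem hbv haN hav hne.symm
      have hno : ∀ y, Sum.inr y ∉ sel j := fun y hc => by
        have := hsel j _ _ hj hc
        simp at this
      rcases he.mem_boundary_or he' hab with h1 | h1
      · exact ⟨e, h1, (hcol e hev i).2 ⟨j, a, he, fun hv => ⟨hvi hv, hno a⟩,
          fun _ => ⟨a, b, hj, Or.inl rfl⟩⟩, hev⟩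
      · exact ⟨e', h1, (hcol e' hev' i).2 ⟨j, b, he', fun hv => ⟨hvi hv, hno b⟩,
          fun _ => ⟨a, b, hj, Or.inr rfl⟩⟩, hev'⟩
    · have hw : ∀ w ∉ S, w ∈ terminals g S v (fun e => some (pc e)) i →
          (∀ s ∈ S, s ≠ v → ¬ (w ∈ X ↔ s ∈ X)) →
          ∃ e ∈ boundary g X, col e = some i ∧ e ∉ boundary g {v} := by
        rintro w hwS ⟨hwv, hw⟩ hs
        obtain ⟨e, hj, hpc⟩ := hw.resolve_left hwS
        have hpart : IsPart g S e v (Sum.inr w) := ⟨hwS, h.mem, hj.symm⟩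
        have hci : c (Sum.inr w) = i := (hc e _ hpart).trans (by simpa using hpc)
        have hvN : v ∈ hyperedge g S (Sum.inr w) := mem_hyperedge.2 ⟨e, hpart⟩
        have h3 : #(hyperedge g S (Sum.inr w : E ⊕ V)) = 3 := by
          have := hR.card_hyperedge_inr w
          have := card_pos.2 ⟨v, hvN⟩
          omega
        obtain ⟨y, hy, hyr⟩ : ∃ y ∈ (hyperedge g S (Sum.inr w)).erase v,
            Sum.inr y ∉ sel (Sum.inr w) := by
          obtain ⟨y, hy, y', hy', hne⟩ := Finset.one_lt_card.1
            (show 1 < #((hyperedge g S (Sum.inr w)).erase v) by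
              rw [card_erase_of_mem hvN]; omega)
          by_contra! hcon
          have := hsel _ _ _ (hcon y hy) (hcon y' hy')
          simp only [Sum.inr.injEq] at this
          exact hne this
        obtain ⟨hyv, hyN⟩ := mem_erase.1 hy
        obtain ⟨f, hf⟩ := hpt y _ hyN
        have hfv : f ∉ boundary g {v} := by
          rw [hf.2.2.mem_boundary_iff]
          simp [hwv, hyv]
        refine ⟨f, ?_, (hcol f hfv i).2 ⟨_, y, hf, fun _ => ⟨hci.symm, hyr⟩,
          fun hc => absurd hvN hc⟩, hfv⟩
        rw [hf.2.2.mem_boundary_iff]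
        exact hs y hf.2.1 hyv
      obtain ⟨s₀, hs₀, hs₀v⟩ := h.exists_ne
      by_cases hs₀X : s₀ ∈ X
      · have hall : ∀ s ∈ S, s ≠ v → s ∈ X := by
          intro s hs hsv
          by_contra hc
          exact hsep ⟨⟨s₀, hs₀, hs₀v, hs₀X⟩, s, hs, hsv, hc⟩
        exact hw x₂ (fun hc => hx₂X (hall x₂ hc hx₂.1)) hx₂ fun s hs hsv =>
          fun hc => hx₂X (hc.2 (hall s hs hsv))
      · have hall : ∀ s ∈ S, s ≠ v → s ∉ X := by
          intro s hs hsv hc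
          exact hsep ⟨⟨s, hs, hsv, hc⟩, s₀, hs₀, hs₀v, hs₀X⟩
        exact hw x₁ (fun hc => hall x₁ hc hx₁.1 hx₁X) hx₁ fun s hs hsv =>
          fun hc => hall s hs hsv (hc.1 hx₁X)
  refine ⟨col, ⟨hcolv, hlinked⟩, fun x hx hxv => ?_⟩
  by_cases hother : ∃ s ∈ S, s ≠ v ∧ s ≠ x
  · obtain ⟨s, hs, hsv, hsx⟩ := hother
    have htree : ∀ i, ∃ e ∈ boundary g {x}, col e = some i ∧ e ∉ boundary g {v} := by
      intro i
      exact hlinked i {x} ⟨x, ⟨hxv, Or.inl hx⟩, rfl⟩ ⟨s, ⟨hsv, Or.inl hs⟩, hsx⟩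
    have hR' : #{j : E ⊕ V | Sum.inr x ∈ sel j} ≤ #{e ∈ boundary g {x} | col e = none} := by
      have hD : ∀ j, Sum.inr x ∈ sel j → ∃ e, IsPart g S e x j := fun j hj =>
        hpt x j (hinr j x hj).1
      choose! D hD using hD
      refine card_le_card_of_injOn D (fun j hj => ?_) fun j hj j' hj' heq => ?_
      · have hj := (mem_filter.1 (mem_coe.1 hj)).2
        have h1 := hD j hj
        have hDv : D j ∉ boundary g {v} := by
          have : 2 ≤ #((hyperedge g S j).erase x) ∨ v ∉ hyperedge g S j := by
            by_cases hv : v ∈ hyperedge g S j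
            · left
              rw [card_erase_of_mem (hinr j x hj).1, (hinr j x hj).2.2 hv]
            · exact Or.inr hv
          rcases this with h2 | h2
          · obtain ⟨b, hb, hbv⟩ := exists_mem_ne h2 v
            exact h1.notMem_boundary h.mem hxv (mem_of_mem_erase hb) hbv (ne_of_mem_erase hb).symm
          · intro hDv
            obtain ⟨j', hj'⟩ := hE _ hDv
            rw [← h1.eq hj'] at hj'
            exact h2 (mem_hyperedge.2 ⟨_, hj'⟩)
        refine mem_coe.2 (mem_filter.2 ⟨h1.mem_boundary, ?_⟩)
        rw [Option.eq_none_iff_forall_ne_some]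
        intro i hi
        obtain ⟨j', y, h4, h5, h6⟩ := (hcol _ hDv i).1 hi
        obtain rfl := h1.eq h4
        by_cases hv : v ∈ hyperedge g S j
        · have hyx : y = x := by
            rcases j with f | w
            · have := (hinr _ x hj).2.2 hv
              have := card_hyperedge_inl_le (g := g) (S := S) f
              omega
            · rcases h1.2.2.unique h4.2.2 with h7 | h7
              · exact h7.2.symm
              · exact absurd (h7.1 ▸ h4.2.1) h1.1
          exact (h5 hv).2 (hyx ▸ hj)
        · obtain ⟨a, b, h7, -⟩ := h6 hv
          have := hsel j _ _ h7 hj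
          simp at this
      · have h1 := hD j (mem_filter.1 (mem_coe.1 hj)).2
        have h2 := hD j' (mem_filter.1 (mem_coe.1 hj')).2
        rw [heq] at h1
        exact h1.eq h2
    obtain ⟨q, hq⟩ : ∃ q : E → Fin k, ∀ i, (¬ ∃ j, hyperedge g S j = {v, x} ∧ c j = i) →
        ∃ e ∈ boundary g {x}, col e = none ∧ q e = i := by
      have hle := (hres x (Set.mem_toFinset.2 hx) hxv).trans hR'
      obtain ⟨q, hq⟩ := exists_surjOn_of_card_le hle
      refine ⟨q, fun i hi => ?_⟩
      obtain ⟨e, he, hqe⟩ := hq i (mem_filter.2 ⟨mem_univ _, hi⟩)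
      obtain ⟨h1, h2⟩ := mem_filter.1 he
      exact ⟨e, h1, h2, hqe⟩
    refine ⟨fun e => (col e).getD (q e), fun e _ i hi => by simp [hi], fun i => ?_⟩
    obtain ⟨e₁, he₁, hc₁, hv₁⟩ := htree i
    obtain ⟨e₂, he₂, hne, hq₂⟩ : ∃ e₂ ∈ boundary g {x}, e₂ ≠ e₁ ∧ (col e₂).getD (q e₂) = i := by
      by_cases hj : ∃ j, hyperedge g S j = {v, x} ∧ c j = i
      · obtain ⟨j, hj, hci⟩ := hj
        obtain ⟨e, he⟩ := hpt v j (by simp [hj])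
        have hev := he.mem_boundary
        refine ⟨e, ?_, fun hc => hv₁ (hc ▸ hev), ?_⟩
        · obtain ⟨e', he'⟩ := hpt x j (by simp [hj])
          rcases j with f | w
          · rw [← he.1, he'.1]
            exact he'.mem_boundary
          · have := hR.card_hyperedge_inr w
            rw [hj, card_pair hxv.symm] at this
            omega
        · rw [hcolv e hev, Option.getD_some, ← hci, hc e j he]
      · obtain ⟨e, he, hn, hqe⟩ := hq i hj
        refine ⟨e, he, fun hc => ?_, by simp [hn, hqe]⟩
        rw [hc, hc₁] at hn
        simp at hn
    exact Finset.one_lt_card.2 ⟨e₁, mem_filter.2 ⟨he₁, by simp [hc₁]⟩, e₂,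
      mem_filter.2 ⟨he₂, hq₂⟩, hne.symm⟩
  · push Not at hother
    have hvx : boundary g {v} ⊆ boundary g {x} := by
      intro e he
      obtain ⟨j, hj⟩ := hE e he
      rcases j with f | w
      · obtain ⟨rfl, -, b, hb, hbv, hj⟩ := hj
        rw [← hother b hb hbv]
        exact hj.symm.mem_boundary_of_mem rfl hbv.symm
      · exfalso
        have h1 : v ∈ hyperedge g S (Sum.inr w : E ⊕ V) := mem_hyperedge.2 ⟨e, hj⟩
        have h2 : hyperedge g S (Sum.inr w : E ⊕ V) ⊆ {v, x} := by
          intro y hy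
          by_cases hyv : y = v
          · simp [hyv]
          · simp [hother y (hmemS _ _ hy) hyv]
        have h3 := (card_le_card h2).trans card_le_two
        have h4 := card_pos.2 ⟨v, h1⟩
        have := hR.card_hyperedge_inr w
        omega
    refine ⟨fun e => (col e).getD (pc e), fun e _ i hi => by simp [hi],
      fun i => (h.two_le i).trans (card_le_card fun e he => ?_)⟩
    obtain ⟨h1, h2⟩ := mem_filter.1 he
    exact mem_filter.2 ⟨hvx h1, by simp [hcolv e h1, h2]⟩

end

section
open Classical Finset

/-- Every balanced colouring of the edges at a vertex of degree `Q` extends to a packing. -/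
theorem IsRooted.hasBalancedPacking {V E : Type} [Fintype V] [Fintype E] {k Q : ℕ}
    {g : E → V × V} {S : Set V} {v : V} {pc : E → Fin k} (h : IsRooted Q g S v pc) (hk : 0 < k)
    (hQ : 7 * k ≤ Q) : HasBalancedPacking g S v pc := by
  induction hn : #(properEdges g) using Nat.strong_induction_on generalizing g S v pc with
  | _ n ih =>
  have ih' : ∀ (g' : E → V × V) (S' : Set V) (v' : V) (pc' : E → Fin k),
      #(properEdges g') < #(properEdges g) → IsRooted Q g' S' v' pc' →
        HasBalancedPacking g' S' v' pc' := fun g' S' v' pc' hlt h' =>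
    ih _ (hn ▸ hlt) h' rfl
  rcases h.tightCutsTrivial_or ih' with hp | hT
  · exact hp
  by_cases hout : ∃ f a b, Joins g f a b ∧ a ∉ S ∧ b ∉ S ∧ a ≠ b
  · obtain ⟨f, a, b, hf, ha, hb, hab⟩ := hout
    exact h.hasBalancedPacking_of_outside hT hf ha hb hab ih'
  have hnb : ∀ w ∉ S, ∀ e y, Joins g e w y → y ≠ w → y ∈ S := by
    intro w hw e y hj hy
    by_contra hyS
    exact hout ⟨e, w, y, hj, hw, hyS, hy.symm⟩
  by_cases hmaj : ∃ f x y, Joins g f x y ∧ x ∉ S ∧ x ≠ y ∧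
      #(boundary g {x}) < 2 * #{e | Joins g e x y}
  · obtain ⟨f, x, y, hf, hx, hxy, hlt⟩ := hmaj
    exact h.hasBalancedPacking_of_majority hf hx hxy hlt ih'
  by_cases hdeg : ∃ x ∉ S, 2 ≤ #(boundary g {x}) ∧ #(boundary g {x}) ≠ 3
  · obtain ⟨x, hx, h2, h3⟩ := hdeg
    exact h.hasBalancedPacking_of_degree hT (by omega) hx (hnb x hx) h2 h3 ih'
  push Not at hmaj hdeg
  have hcard : ∀ w ∉ S, #(boundary g {w}) = 0 ∨ #(boundary g {w}) = 3 := by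
    intro w hw
    have h1 := hdeg w hw
    by_cases h0 : #(boundary g {w}) = 0
    · exact Or.inl h0
    obtain ⟨e, he⟩ := card_pos.1 (Nat.pos_of_ne_zero h0)
    obtain ⟨y, hy, hj⟩ := mem_boundary_singleton.1 he
    have h2 := hmaj e w y hj hw hy.symm
    have h3 : 0 < #{e | Joins g e w y} := card_pos.2 ⟨e, by simpa using hj⟩
    omega
  refine h.hasBalancedPacking_of_isReduced ⟨hnb, fun w hw e e' y hy hj hj' => ?_, hcard⟩ hk hQ
  by_contra hne
  have h2 := hmaj e w y hj hw hy.symm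
  have h3 : 1 < #{e | Joins g e w y} :=
    Finset.one_lt_card.2 ⟨e, by simpa using hj, e', by simpa using hj', hne⟩
  have := hcard w hw
  omega

end

section
open Classical Finset

/-- The colour classes of `col` all connect `S`. -/
def Packs {V E : Type} [Fintype E] {k : ℕ} (g : E → V × V) (col : E → Option (Fin k)) (S : Set V) :
    Prop :=
  ∀ i, Linked g (fun e => col e = some i) S

variable {V E : Type} [Fintype E] {k Q : ℕ} {g : E → V × V} {S T : Set V}

theorem Packs.mono {col : E → Option (Fin k)} (h : Packs g col S) (hT : T ⊆ S) : Packs g col T :=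
  fun i => (h i).mono (fun _ h => h) hT

theorem packs_empty (col : E → Option (Fin k)) : Packs g col ∅ := by
  rintro i X ⟨s, hs, -⟩
  exact absurd hs (Set.notMem_empty s)

theorem CutBound.mono {Q' : ℕ} (h : CutBound g S Q) (hQ : Q' ≤ Q) : CutBound g S Q' :=
  fun X h1 h2 => hQ.trans (h X h1 h2)

theorem CutBound.mapEnds_of_fixed (h : CutBound g S Q) {π : V → V} (hπ : ∀ s ∈ S, π s = s) :
    CutBound (mapEnds π g) S Q := by
  rintro X ⟨s, hs, hsX⟩ ⟨t, ht, htX⟩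
  rw [boundary_mapEnds]
  exact h _ ⟨s, hs, by simpa [hπ s hs] using hsX⟩ ⟨t, ht, by simpa [hπ t ht] using htX⟩

/-- Every partial colouring of the edges at a vertex of small degree extends to a packing. -/
theorem exists_extends [Fintype V] (hk : 0 < k) (hQ : 7 * k ≤ Q) (hcut : CutBound g S Q)
    (hS : S.Nonempty) {v : V} (hv : v ∉ S) (hd : #(boundary g {v}) + 2 * k ≤ Q)
    (hmin : ∀ X : Set V, v ∈ X → (∀ s ∈ S, s ∉ X) → #(boundary g {v}) ≤ #(boundary g X))
    (pc : E → Option (Fin k)) : ∃ col, Extends g S v pc col := by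
  obtain ⟨s₀, hs₀⟩ := hS
  have hsv : s₀ ≠ v := fun hc => hv (hc ▸ hs₀)
  obtain ⟨m, hm⟩ : ∃ m, m = Q - #(boundary g {v}) := ⟨_, rfl⟩
  set g' : E ⊕ Fin m → V × V := Sum.elim g fun _ => (v, s₀) with hg'
  set pc' : E ⊕ Fin m → Fin k :=
    Sum.elim (fun e => (pc e).getD ⟨0, hk⟩) fun i => ⟨i % k, Nat.mod_lt _ hk⟩ with hpc'
  have hl : ∀ X e, Sum.inl e ∈ boundary g' X ↔ e ∈ boundary g X := by
    intro X e
    simp [hg', mem_boundary]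
  have hr : ∀ X i, Sum.inr i ∈ boundary g' X ↔ ¬ (v ∈ X ↔ s₀ ∈ X) := by
    intro X i
    simp [hg', mem_boundary]
  have hcard : ∀ X : Set V, ¬ (v ∈ X ↔ s₀ ∈ X) → #(boundary g' X) = #(boundary g X) + m := by
    intro X hX
    have : boundary g' X = (boundary g X).disjSum univ := by
      ext (e | i)
      · rw [hl, inl_mem_disjSum]
      · rw [hr, inr_mem_disjSum]
        simp [hX]
    rw [this, card_disjSum, card_univ, Fintype.card_fin]
  have hle : ∀ X : Set V, #(boundary g X) ≤ #(boundary g' X) := by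
    intro X
    refine card_le_card_of_injOn Sum.inl (fun e he => ?_) Sum.inl_injective.injOn
    exact mem_coe.2 ((hl X e).2 he)
  have key : ∀ X : Set V, v ∈ X → (∀ s ∈ S, s ∉ X) → Q ≤ #(boundary g' X) := by
    intro X hvX hX
    have h1 := hcard X (by have := hX s₀ hs₀; tauto)
    have h2 := hmin X hvX hX
    omega
  have hroot : IsRooted Q g' (S ∪ {v}) v pc' := by
    refine ⟨?_, Or.inr rfl, ⟨s₀, Or.inl hs₀, hsv⟩, ?_, ?_⟩
    · rintro X ⟨x, hx, hxX⟩ ⟨y, hy, hyX⟩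
      by_cases h1 : ∃ s ∈ S, s ∈ X
      · by_cases h2 : ∃ s ∈ S, s ∉ X
        · exact (hcut X h1 h2).trans (hle X)
        · push Not at h2
          have hvX : v ∉ X := by
            rcases hy with hy | hy
            · exact absurd (h2 y hy) hyX
            · exact Set.mem_singleton_iff.1 hy ▸ hyX
          rw [← boundary_compl]
          exact key Xᶜ hvX fun s hs hc => hc (h2 s hs)
      · push Not at h1
        have hvX : v ∈ X := by
          rcases hx with hx | hx
          · exact absurd hxX (h1 x hx)
          · exact Set.mem_singleton_iff.1 hx ▸ hxX
        exact key X hvX h1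
    · rw [hcard {v} (by simp [hsv])]
      omega
    · intro i
      have hi := i.2
      refine Finset.one_lt_card.2 ⟨Sum.inr ⟨i, by omega⟩, ?_, Sum.inr ⟨i + k, by omega⟩, ?_, ?_⟩
      · refine mem_filter.2 ⟨(hr _ _).2 (by simp [hsv]), ?_⟩
        ext
        simp [hpc', Nat.mod_eq_of_lt hi]
      · refine mem_filter.2 ⟨(hr _ _).2 (by simp [hsv]), ?_⟩
        ext
        simp [hpc', Nat.mod_eq_of_lt hi]
      · simp only [ne_eq, Sum.inr.injEq, Fin.mk.injEq]
        omega
  obtain ⟨col', hext, -⟩ := hroot.hasBalancedPacking hk hQ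
  refine ⟨fun e => if e ∈ boundary g {v} then pc e else col' (Sum.inl e),
    fun e he => by simp [he], fun i => ?_⟩
  have hsub : terminals g S v pc i ⊆ terminals g' (S ∪ {v}) v (fun e => some (pc' e)) i := by
    rintro x ⟨hxv, hx⟩
    refine ⟨hxv, hx.imp Or.inl ?_⟩
    rintro ⟨e, hj, hpc⟩
    exact ⟨Sum.inl e, hj, by simp [hpc', hpc]⟩
  intro X h1 h2
  obtain ⟨e | j, he, hcol, hev⟩ := ((hext.linked i).mono (fun _ h => h) hsub) X h1 h2
  · rw [hl] at he hev
    exact ⟨e, he, by simp [hev, hcol], hev⟩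
  · exact absurd ((hr _ _).2 (by simp [hsv])) hev

theorem CutBound.exists_packs [Fintype V] (h : CutBound g S Q) (hk : 0 < k) (hQ : 7 * k ≤ Q) :
    ∃ col : E → Option (Fin k), Packs g col S := by
  rcases S.eq_empty_or_nonempty with rfl | hS
  · exact ⟨fun _ => none, packs_empty _⟩
  have h0 : boundary (mapEnds some g) {none} = ∅ := by
    rw [boundary_mapEnds]
    refine eq_empty_of_forall_notMem fun e he => ?_
    simp [mem_boundary] at he
  obtain ⟨col, hext⟩ := exists_extends (g := mapEnds some g) (S := some '' S) hk hQ
    (by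
      rintro X ⟨_, ⟨s, hs, rfl⟩, hsX⟩ ⟨_, ⟨t, ht, rfl⟩, htX⟩
      rw [boundary_mapEnds]
      exact h (some ⁻¹' X) ⟨s, hs, hsX⟩ ⟨t, ht, htX⟩)
    (hS.image some) (v := none) (by simp) (by rw [h0, card_empty]; omega)
    (fun X _ _ => by rw [h0, card_empty]; omega) fun _ => none
  refine ⟨col, fun i X ⟨s, hs, hsX⟩ ⟨t, ht, htX⟩ => ?_⟩
  obtain ⟨e, he, hcol, -⟩ := hext.linked i (some '' X)
    ⟨some s, ⟨by simp, Or.inl ⟨s, hs, rfl⟩⟩, ⟨s, hsX, rfl⟩⟩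
    ⟨some t, ⟨by simp, Or.inl ⟨t, ht, rfl⟩⟩, by simpa using htX⟩
  rw [boundary_mapEnds, Set.preimage_image_eq _ (Option.some_injective V)] at he
  exact ⟨e, he, hcol⟩

/-- A packing in the contraction of `B` and an extension inside `B` give a packing. -/
theorem exists_packs_of_cut [Fintype V] (hk : 0 < k) (hQ : 7 * k ≤ Q) (hcut : CutBound g S Q)
    {B : Set V} (hSB : S ⊆ B) {b : V} (hb : b ∈ S) (hB : Bᶜ.Nonempty)
    (hd : #(boundary g B) + 2 * k ≤ Q)
    (hmin : ∀ Y, S ⊆ Y → Y ⊆ B → #(boundary g B) ≤ #(boundary g Y)) (col₁ : E → Option (Fin k)) :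
    ∃ col : E → Option (Fin k), Packs g col S ∧
      ∀ T, T ⊆ Bᶜ → Packs (mapEnds (collapse B b) g) col₁ T → Packs g col T := by
  obtain ⟨a, ha⟩ := hB
  have hb₂ : boundary (mapEnds (collapse Bᶜ a) g) {a} = boundary g B := by
    rw [boundary_mapEnds, collapse_preimage_singleton ha, boundary_compl]
  have hfix : ∀ s ∈ B, collapse Bᶜ a s = s := fun s hs => collapse_of_notMem fun hc => hc hs
  obtain ⟨col₂, hext⟩ := exists_extends hk hQ
    (hcut.mapEnds_of_fixed (π := collapse Bᶜ a) fun s hs => hfix s (hSB hs)) ⟨b, hb⟩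
    (v := a) (fun hc => ha (hSB hc)) (by rw [hb₂]; exact hd)
    (by
      intro X haX hX
      rw [hb₂, boundary_mapEnds, ← boundary_compl (collapse Bᶜ a ⁻¹' X)]
      refine hmin _ (fun s hs hc => hX s hs ?_) fun y hy => ?_
      · rwa [Set.mem_preimage, hfix s (hSB hs)] at hc
      · by_contra hyB
        refine hy ?_
        rwa [Set.mem_preimage, collapse_of_mem (show y ∈ Bᶜ from hyB)]) col₁
  have hlink := hext.linked
  rw [hb₂] at hlink
  have hST : ∀ i, S ⊆ terminals (mapEnds (collapse Bᶜ a) g) S a col₁ i :=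
    fun i s hs => ⟨fun hc => ha (hc ▸ hSB hs), Or.inl hs⟩
  refine ⟨combine g B col₁ col₂, fun i X h1 h2 => ?_, fun T hT hpack i => ?_⟩
  · obtain ⟨e, c, d, hj, hc, hd, -, -, hcol⟩ := ((hlink i).mono (fun _ h => h)
      (hST i)).combine_inner (col₁ := col₁) h1 h2
    exact ⟨e, hj.mem_boundary_of_mem hc hd, hcol⟩
  · have h₁ : Linked (mapEnds (collapse B b) g) (fun e => col₁ e = some i ∧ True) T :=
      (hpack i).mono (fun _ h => ⟨h, trivial⟩) subset_rfl
    refine (Linked.combine_outer (hST i hb) h₁ (hlink i) ?_ (fun _ _ _ _ _ _ => trivial)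
      fun x hx => Or.inl ⟨hT hx, hx⟩).mono (fun _ h => h.1) subset_rfl
    intro e x y hj hx hy hcol
    refine ⟨fun hc => ha (hc ▸ hx), Or.inr ⟨e, ?_, hcol⟩⟩
    have := (hj.mapEnds (π := collapse Bᶜ a)).symm
    rwa [collapse_of_mem (show y ∈ Bᶜ from hy), hfix x hx] at this

end

section
open Classical Finset

/-- The cut `X` is a minimum cut among those separating `S` from `T`. -/
structure IsMinCut {V E : Type} [Fintype E] (g : E → V × V) (S T X : Set V) : Prop where
  left : S ⊆ X
  right : T ⊆ Xᶜ
  le : ∀ Y, S ⊆ Y → T ⊆ Yᶜ → #(boundary g X) ≤ #(boundary g Y)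

variable {V E : Type} [Fintype E] {k Q τ : ℕ} {g : E → V × V} {S T X : Set V}

theorem IsMinCut.symm (h : IsMinCut g S T X) : IsMinCut g T S Xᶜ := by
  refine ⟨h.right, by simpa using h.left, fun Y h1 h2 => ?_⟩
  rw [boundary_compl, ← boundary_compl Y]
  exact h.le _ h2 (by simpa using h1)

theorem exists_isMinCut (h1 : S ⊆ X) (h2 : T ⊆ Xᶜ) :
    ∃ B, IsMinCut g S T B ∧ #(boundary g B) ≤ #(boundary g X) := by
  have hex : ∃ n, ∃ Y, S ⊆ Y ∧ T ⊆ Yᶜ ∧ #(boundary g Y) = n := ⟨_, X, h1, h2, rfl⟩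
  obtain ⟨B, hB1, hB2, hB3⟩ := Nat.find_spec hex
  refine ⟨B, ⟨hB1, hB2, fun Y hY1 hY2 => ?_⟩, ?_⟩
  · exact hB3.trans_le (Nat.find_min' hex ⟨Y, hY1, hY2, rfl⟩)
  · exact hB3.trans_le (Nat.find_min' hex ⟨X, h1, h2, rfl⟩)

theorem CutBound.subset_or_subset_compl (h : CutBound g S Q) (hX : #(boundary g X) < Q) :
    S ⊆ X ∨ S ⊆ Xᶜ := by
  by_contra! hc
  obtain ⟨⟨s, hs, hsX⟩, t, ht, htX⟩ := And.imp Set.not_subset.1 Set.not_subset.1 hc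
  exact hX.not_ge (h X ⟨t, ht, by simpa using htX⟩ ⟨s, hs, hsX⟩)

theorem CutBound.exists_isMinCut (hS : CutBound g S Q) (hT : CutBound g T Q) (hτ : τ ≤ Q)
    (h : ¬ CutBound g (S ∪ T) τ) :
    S.Nonempty ∧ ∃ B, IsMinCut g S T B ∧ #(boundary g B) < τ := by
  refine ⟨?_, ?_⟩
  · rw [Set.nonempty_iff_ne_empty]
    rintro rfl
    exact h (by simpa using hT.mono hτ)
  · simp only [CutBound, not_forall, not_le] at h
    obtain ⟨X, ⟨s, hs, hsX⟩, ⟨t, ht, htX⟩, hX⟩ := h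
    have key : ∀ Y : Set V, #(boundary g Y) < τ → S ⊆ Y → T ⊆ Yᶜ →
        ∃ B, IsMinCut g S T B ∧ #(boundary g B) < τ := by
      intro Y hY h1 h2
      obtain ⟨B, hB, hle⟩ := SteinerPacking.exists_isMinCut (g := g) h1 h2
      exact ⟨B, hB, hle.trans_lt hY⟩
    rcases hS.subset_or_subset_compl (hX.trans_le hτ) with h1 | h1 <;>
      rcases hT.subset_or_subset_compl (hX.trans_le hτ) with h2 | h2
    · exact absurd (ht.elim (@h1 t) (@h2 t)) htX
    · exact key X hX h1 h2
    · exact key Xᶜ (by rwa [boundary_compl]) h1 (by simpa using h2)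
    · exact absurd hsX (hs.elim (@h1 s) (@h2 s))

/-- Two sets, one of them with a slightly higher connectivity, can be packed simultaneously. -/
theorem exists_packs_pair [Fintype V] (hk : 0 < k) (hQ : 7 * k ≤ Q)
    (hS : CutBound g S (Q + 2 * k)) (hT : CutBound g T Q) :
    ∃ col : E → Option (Fin k), Packs g col S ∧ Packs g col T := by
  by_cases h : CutBound g (S ∪ T) Q
  · obtain ⟨col, hcol⟩ := h.exists_packs hk hQ
    exact ⟨col, hcol.mono Set.subset_union_left, hcol.mono Set.subset_union_right⟩
  obtain ⟨⟨b, hb⟩, B, hB, hd⟩ := (hS.mono (Nat.le_add_right _ _)).exists_isMinCut hT le_rfl h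
  obtain ⟨⟨a, ha⟩, -⟩ := hT.exists_isMinCut (hS.mono (Nat.le_add_right _ _)) le_rfl
    (by rwa [Set.union_comm])
  obtain ⟨col₁, hcol₁⟩ := (hT.mapEnds_of_fixed (π := collapse B b) fun s hs =>
    collapse_of_notMem (hB.right hs)).exists_packs hk hQ
  obtain ⟨col, h1, h2⟩ := exists_packs_of_cut hk (by omega) hS hB.left hb ⟨a, hB.right ha⟩
    (by omega) (fun Y hY hYB => hB.le Y hY (hB.right.trans (Set.compl_subset_compl.2 hYB))) col₁
  exact ⟨col, h1, h2 T hB.right hcol₁⟩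

/-- If no two sets of a family are well connected to each other, some minimum cut separates a single
set from all others. -/
theorem exists_leaf {ι : Type} {I : Finset ι} {S : ι → Set V} (hS : ∀ i ∈ I, CutBound g (S i) Q)
    (hI : 1 < #I) (hτ : τ ≤ Q)
    (hsep : ∀ i ∈ I, ∀ j ∈ I, i ≠ j → ¬ CutBound g (S i ∪ S j) τ) :
    ∃ j ∈ I, ∃ l ∈ I, ∃ B, l ≠ j ∧ IsMinCut g (S j) (S l) B ∧ #(boundary g B) < τ ∧
      ∀ i ∈ I, i ≠ j → S i ⊆ Bᶜ := by
  have hpair : ∀ i ∈ I, ∀ j ∈ I, i ≠ j →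
      (S i).Nonempty ∧ ∃ B, IsMinCut g (S i) (S j) B ∧ #(boundary g B) < τ :=
    fun i hi j hj hij => (hS i hi).exists_isMinCut (hS j hj) hτ (hsep i hi j hj hij)
  have main : ∀ n, ∀ j ∈ I, ∀ l ∈ I, ∀ B, l ≠ j → IsMinCut g (S j) (S l) B →
      #(boundary g B) < τ → #{i ∈ I | S i ⊆ B} = n →
      ∃ j ∈ I, ∃ l ∈ I, ∃ B, l ≠ j ∧ IsMinCut g (S j) (S l) B ∧ #(boundary g B) < τ ∧
        ∀ i ∈ I, i ≠ j → S i ⊆ Bᶜ := by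
    intro n
    induction n using Nat.strong_induction_on with
    | _ n ih =>
    intro j hj l hl B hlj hB hd hn
    by_cases hall : ∀ i ∈ I, i ≠ j → S i ⊆ Bᶜ
    · exact ⟨j, hj, l, hl, B, hlj, hB, hd, hall⟩
    push Not at hall
    obtain ⟨i, hi, hij, hiB⟩ := hall
    replace hiB : S i ⊆ B :=
      ((hS i hi).subset_or_subset_compl (hd.trans_le hτ)).resolve_right hiB
    have key : ∀ p ∈ I, ∀ q ∈ I, q ≠ p → S p ⊆ B → S q ⊆ B → ∀ C, IsMinCut g (S p) (S q) C →
        #(boundary g C) < τ → S l ⊆ Cᶜ →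
        ∃ j ∈ I, ∃ l ∈ I, ∃ B, l ≠ j ∧ IsMinCut g (S j) (S l) B ∧ #(boundary g B) < τ ∧
          ∀ i ∈ I, i ≠ j → S i ⊆ Bᶜ := by
      intro p hp q hq hqp hpB hqB C hC hdC hlC
      have h1 := hB.le (C ∪ B) (hB.left.trans Set.subset_union_right)
        (by rw [Set.compl_union]; exact Set.subset_inter hlC hB.right)
      have h2 := card_boundary_inter_add_union (g := g) C B
      have hqC : S q ⊆ (C ∩ B)ᶜ := fun x hx hc => hC.right hx hc.1
      refine ih _ ?_ p hp q hq (C ∩ B) hqp ⟨Set.subset_inter hC.left hpB, hqC, fun Y hY1 hY2 => ?_⟩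
        (by omega) rfl
      · rw [← hn]
        refine card_lt_card (ssubset_iff_of_subset (fun x hx => ?_) |>.2 ⟨q, ?_, fun hc => ?_⟩)
        · rw [mem_filter] at hx ⊢
          exact ⟨hx.1, hx.2.trans Set.inter_subset_right⟩
        · exact mem_filter.2 ⟨hq, hqB⟩
        · obtain ⟨x, hx⟩ := (hpair q hq p hp hqp).1
          exact hqC hx ((mem_filter.1 hc).2 hx)
      · have := hC.le Y hY1 hY2
        omega
    obtain ⟨-, C, hC, hdC⟩ := hpair i hi j hj hij
    rcases (hS l hl).subset_or_subset_compl (hdC.trans_le hτ) with hlC | hlC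
    · exact key j hj i hi hij hB.left hiB Cᶜ hC.symm (by rwa [boundary_compl]) (by simpa using hlC)
    · exact key i hi j hj hij.symm hiB hB.left C hC hdC hlC
  obtain ⟨j, hj, l, hl, hjl⟩ := one_lt_card.1 hI
  obtain ⟨-, B, hB, hd⟩ := hpair j hj l hl hjl
  exact main _ j hj l hl B hjl.symm hB hd rfl

/-- A family of `n + 2` sets of connectivity `7 * k + 2 * k * n` can be packed simultaneously,
provided that for `n = 0` one of the sets has a slightly higher connectivity. -/
theorem exists_packs_family [Fintype V] {ι : Type} (hk : 0 < k) (n : ℕ) :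
    ∀ (Q : ℕ) (g : E → V × V) (S : ι → Set V) (I : Finset ι), 7 * k + 2 * (k * n) ≤ Q →
      #I = n + 2 → (∀ i ∈ I, CutBound g (S i) Q) →
      (n = 0 → ∃ i ∈ I, ∀ j ∈ I, j ≠ i → CutBound g (S j) (Q + 2 * k)) →
      ∃ col : E → Option (Fin k), ∀ i ∈ I, Packs g col (S i) := by
  induction n with
  | zero =>
    intro Q g S I hQ hI hS h0
    obtain ⟨i, hi, hlarge⟩ := h0 rfl
    obtain ⟨j, hj⟩ := card_eq_one.1 (show #(I.erase i) = 1 by rw [card_erase_of_mem hi]; omega)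
    have hjI : j ∈ I.erase i := hj ▸ mem_singleton_self j
    obtain ⟨col, h1, h2⟩ := exists_packs_pair hk (by omega)
      (hlarge j (mem_of_mem_erase hjI) (ne_of_mem_erase hjI)) (hS i hi)
    refine ⟨col, fun x hx => ?_⟩
    by_cases hxi : x = i
    · exact hxi ▸ h2
    · have : x ∈ I.erase i := mem_erase.2 ⟨hxi, hx⟩
      rw [hj, mem_singleton] at this
      exact this ▸ h1
  | succ n ih =>
    intro Q g S I hQ hI hS _
    have hkn : k * (n + 1) = k * n + k := by ring
    have hsub : Q - 2 * k ≤ Q := Nat.sub_le _ _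
    have hadd : Q - 2 * k + 2 * k ≤ Q := by omega
    by_cases hsep : ∀ i ∈ I, ∀ j ∈ I, i ≠ j → ¬ CutBound g (S i ∪ S j) (Q - 2 * k)
    · obtain ⟨j, hj, l, hl, B, hlj, hB, hd, hother⟩ := exists_leaf hS (by omega) hsub hsep
      obtain ⟨⟨b, hb⟩, -⟩ := (hS j hj).exists_isMinCut (hS l hl) hsub (hsep j hj l hl hlj.symm)
      obtain ⟨⟨a, ha⟩, -⟩ := (hS l hl).exists_isMinCut (hS j hj) hsub (hsep l hl j hj hlj)
      have hcut : ∀ i ∈ I.erase j, CutBound (mapEnds (collapse B b) g) (S i) Q := by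
        intro i hi
        refine (hS i (mem_of_mem_erase hi)).mapEnds_of_fixed fun s hs => collapse_of_notMem ?_
        exact hother i (mem_of_mem_erase hi) (ne_of_mem_erase hi) hs
      obtain ⟨col₁, hcol₁⟩ := ih (Q - 2 * k) (mapEnds (collapse B b) g) S (I.erase j) (by omega)
        (by rw [card_erase_of_mem hj]; omega) (fun i hi => (hcut i hi).mono hsub)
        fun _ => ⟨l, mem_erase.2 ⟨hlj, hl⟩, fun i hi _ => (hcut i hi).mono hadd⟩
      obtain ⟨col, h1, h2⟩ := exists_packs_of_cut hk (by omega) (hS j hj) hB.left hb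
        ⟨a, hB.right ha⟩ (by omega)
        (fun Y hY hYB => hB.le Y hY (hB.right.trans (Set.compl_subset_compl.2 hYB))) col₁
      refine ⟨col, fun i hi => ?_⟩
      by_cases hij : i = j
      · exact hij ▸ h1
      · exact h2 _ (hother i hi hij) (hcol₁ i (mem_erase.2 ⟨hij, hi⟩))
    · push Not at hsep
      obtain ⟨i, hi, j, hj, hij, hun⟩ := hsep
      have hcut : ∀ x ∈ I.erase j, x ≠ i →
          CutBound g (Function.update S i (S i ∪ S j) x) Q := by
        intro x hx hxi
        rw [Function.update_of_ne hxi]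
        exact hS x (mem_of_mem_erase hx)
      obtain ⟨col, hcol⟩ := ih (Q - 2 * k) g (Function.update S i (S i ∪ S j)) (I.erase j)
        (by omega) (by rw [card_erase_of_mem hj]; omega)
        (fun x hx => by
          by_cases hxi : x = i
          · subst hxi
            rwa [Function.update_self]
          · exact (hcut x hx hxi).mono hsub)
        fun _ => ⟨i, mem_erase.2 ⟨hij, hi⟩, fun x hx hxi => (hcut x hx hxi).mono hadd⟩
      have hpi := hcol i (mem_erase.2 ⟨hij, hi⟩)
      rw [Function.update_self] at hpi
      refine ⟨col, fun x hx => ?_⟩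
      by_cases hxi : x = i
      · exact hpi.mono (hxi ▸ Set.subset_union_left)
      by_cases hxj : x = j
      · exact hpi.mono (hxj ▸ Set.subset_union_right)
      · have := hcol x (mem_erase.2 ⟨hxj, hx⟩)
        rwa [Function.update_of_ne hxi] at this

end

section
open Classical Finset

variable {V E : Type} {ends : E → Sym2 V} {g : E → V × V}

theorem joins_iff_ends_eq (hg : ∀ e, ends e = s((g e).1, (g e).2)) {e : E} {a b : V} :
    Joins g e a b ↔ ends e = s(a, b) := by
  rw [hg, Sym2.eq_iff, Joins, Prod.ext_iff, Prod.ext_iff]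

variable [Fintype E]

theorem IsWalk.exists_mem_boundary (hg : ∀ e, ends e = s((g e).1, (g e).2)) {X : Set V} {u w : V}
    {l : List E} (h : IsWalk ends u w l) (hu : u ∈ X) (hw : w ∉ X) :
    ∃ e ∈ l, e ∈ boundary g X := by
  induction h with
  | nil v => exact absurd hu hw
  | @cons u v w e l he _ ih =>
    by_cases hv : v ∈ X
    · obtain ⟨e', h1, h2⟩ := ih hv hw
      exact ⟨e', List.mem_cons_of_mem _ h1, h2⟩
    · exact ⟨e, List.mem_cons_self, ((joins_iff_ends_eq hg).2 he).mem_boundary_of_mem hu hv⟩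

theorem EdgeConnectedIn.cutBound (hg : ∀ e, ends e = s((g e).1, (g e).2)) {S : Set V} {n : ℕ}
    (h : EdgeConnectedIn ends Set.univ S n) : CutBound g S n := by
  rintro X ⟨a, ha, haX⟩ ⟨b, hb, hbX⟩
  obtain ⟨P, hP, hdisj⟩ := h a ha b hb fun hc => hbX (hc ▸ haX)
  choose f hfP hf using fun i => (hP i).1.exists_mem_boundary hg haX hbX
  have hinj : Function.Injective f := by
    intro i j hij
    by_contra hne
    exact hdisj i j hne _ (hfP i) (hij ▸ hfP j)
  simpa using card_le_card_of_injOn (s := univ) f (fun i _ => mem_coe.2 (hf i)) hinj.injOn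

theorem Linked.connectsSet (hg : ∀ e, ends e = s((g e).1, (g e).2)) {F : E → Prop} {S : Set V}
    (h : Linked g F S) : ConnectsSet ends {e | F e} S := by
  intro a ha b hb
  by_contra hab
  obtain ⟨e, he, hF⟩ := h {x | Reaches ends {e | F e} a x} ⟨a, ha, Relation.ReflTransGen.refl⟩
    ⟨b, hb, hab⟩
  obtain ⟨x, y, hj, hx, hy⟩ := exists_joins_of_mem_boundary he
  exact hy (Relation.ReflTransGen.tail hx ⟨e, hF, (joins_iff_ends_eq hg).1 hj⟩)

end

/-- For every `t ≥ 3` and `k ≥ 1`, if `S 1, …, S t` are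
pairwise vertex-disjoint subsets of a loopless multigraph `G`, each
`((2t+3)k + f(t))`-edge-connected, then there is a packing of `k` pairwise
edge-disjoint `(S 1, …, S t)`-forests in `G`. -/
theorem small_t_packing {V E : Type} [Fintype V] [Fintype E]
    (ends : E → Sym2 V) (hG : Loopless ends)
    (t k : ℕ) (ht : 3 ≤ t) (hk : 0 < k) (S : Fin t → Set V)
    (hdisj : ∀ i j, i ≠ j → Disjoint (S i) (S j))
    (hconn : ∀ i, EdgeConnectedIn ends Set.univ (S i) ((2 * t + 3) * k + fBound t)) :
    ∃ H : Fin k → Set E, PairwiseEdgeDisjoint H ∧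
      ∀ j : Fin k, ∀ i : Fin t, ConnectsSet ends (H j) (S i) := by
  classical
  obtain ⟨n, rfl⟩ : ∃ n, t = n + 2 := ⟨t - 2, by omega⟩
  have hg : ∀ e, ends e = s((Quot.out (ends e)).1, (Quot.out (ends e)).2) :=
    fun e => (Quot.out_eq (ends e)).symm
  have hQ : 7 * k + 2 * (k * n) = (2 * (n + 2) + 3) * k := by ring
  obtain ⟨col, hcol⟩ := exists_packs_family hk n _ (fun e => Quot.out (ends e)) S Finset.univ hQ.le
    (by simp) (fun i _ => ((hconn i).cutBound hg).mono (Nat.le_add_right _ _)) (by omega)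
  refine ⟨fun j => {e | col e = some j}, fun i j hij => Set.disjoint_left.2 fun e hi hj => ?_,
    fun j i => (hcol i (Finset.mem_univ i) j).connectsSet hg⟩
  exact hij (Option.some_injective _ (hi.symm.trans hj))

end SteinerPacking
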